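/- arXiv:1108.6037 — 2 statements merged into one kernel-verified Lean document; each statement's English description precedes it below -/
import Mathlib

section
/- Let H be a non-cosemisimple Hopf algebra with no nontrivial skew-primitive elements whose coradical decomposes as a coalgebra as H₀ ≅ kG ⊕ M*(n,k) ⊕ M*(n₁,k) ⊕ … ⊕ M*(n_t,k), with G = G(H), t ≥ 0 and 2 ≤ n ≤ n₁ ≤ … ≤ n_t. Then dim H ≥ dim H₀ + (2n+1)|G| + n². -/
open TensorProduct

namespace HopfClass

variable (k : Type*) [Field k]

section Wrt

variable {M : Type*} [AddCommGroup M] [Module k M]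

/-- A subspace `C` is a subcoalgebra with respect to a comultiplication-like map `Δ`
if `Δ` maps `C` into the image of `C ⊗ C` in `M ⊗ M`. -/
def IsSubcoalgWrt (Δ : M →ₗ[k] M ⊗[k] M) (C : Submodule k M) : Prop :=
  ∀ x ∈ C, Δ x ∈ LinearMap.range (TensorProduct.map C.subtype C.subtype)

/-- A simple subcoalgebra: a nonzero subcoalgebra with no nonzero proper subcoalgebras. -/
def IsSimpleSubcoalgWrt (Δ : M →ₗ[k] M ⊗[k] M) (C : Submodule k M) : Prop :=
  IsSubcoalgWrt k Δ C ∧ C ≠ ⊥ ∧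
    ∀ D : Submodule k M, IsSubcoalgWrt k Δ D → D < C → D = ⊥

/-- Pointedness: every simple subcoalgebra is one-dimensional. -/
def IsPointedWrt (Δ : M →ₗ[k] M ⊗[k] M) : Prop :=
  ∀ C : Submodule k M, IsSimpleSubcoalgWrt k Δ C → Module.finrank k C = 1

/-- Grouplike element with respect to `Δ`. -/
def IsGrouplikeWrt (Δ : M →ₗ[k] M ⊗[k] M) (g : M) : Prop :=
  g ≠ 0 ∧ Δ g = g ⊗ₜ[k] g

/-- `y` is a `(h, g)`-skew-primitive with respect to `Δ`, i.e. `Δ y = g ⊗ y + y ⊗ h`. -/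
def IsSkewPrimitiveWrt (Δ : M →ₗ[k] M ⊗[k] M) (g h y : M) : Prop :=
  Δ y = g ⊗ₜ[k] y + y ⊗ₜ[k] h

/-- There are no nontrivial skew-primitive elements: every skew-primitive between grouplikes
is a scalar multiple of the difference of the grouplikes. -/
def HasNoNontrivialSkewPrimitivesWrt (Δ : M →ₗ[k] M ⊗[k] M) : Prop :=
  ∀ g h y : M, IsGrouplikeWrt k Δ g → IsGrouplikeWrt k Δ h →
    IsSkewPrimitiveWrt k Δ g h y → ∃ c : k, y = c • (g - h)

end Wrt

section Coalg

variable (H : Type*) [AddCommGroup H] [Module k H] [Coalgebra k H]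

/-- The comultiplication of a coalgebra, as a linear map. -/
noncomputable abbrev comulL : H →ₗ[k] H ⊗[k] H := CoalgebraStruct.comul

/-- The coradical of a coalgebra: the sum of all its simple subcoalgebras. -/
noncomputable def coradical : Submodule k H :=
  sSup {C : Submodule k H | IsSimpleSubcoalgWrt k (comulL k H) C}

/-- A coalgebra is cosemisimple if it equals its coradical. -/
def IsCosemisimple : Prop := coradical k H = ⊤

/-- A coalgebra is pointed if all its simple subcoalgebras are one-dimensional. -/
def IsPointed : Prop := IsPointedWrt k (comulL k H)

/-- The set of grouplike elements. -/
def grouplikes : Set H := {g : H | IsGrouplikeWrt k (comulL k H) g}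

/-- `e` is a multiplicative matrix of size `n` spanning the subspace `C`, i.e. a
linearly independent family with `Δ(e i j) = ∑ l, e i l ⊗ e l j` and `ε(e i j) = δ_ij`
whose span is `C`; this says precisely that `C` is a simple matrix subcoalgebra
isomorphic to `M*(n,k)`, the dual of the `n × n` matrix algebra. -/
def IsMultMatrix (n : ℕ) (C : Submodule k H) (e : Fin n → Fin n → H) : Prop :=
  LinearIndependent k (fun p : Fin n × Fin n => e p.1 p.2) ∧
  C = Submodule.span k (Set.range fun p : Fin n × Fin n => e p.1 p.2) ∧
  (∀ i j, CoalgebraStruct.comul (R := k) (e i j) = ∑ l : Fin n, e i l ⊗ₜ[k] e l j) ∧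
  (∀ i j, Coalgebra.counit (R := k) (e i j) = if i = j then (1 : k) else 0)

/-- `C` is a (simple matrix) subcoalgebra isomorphic to the matrix coalgebra `M*(n,k)`. -/
def IsMatrixSubcoalg (n : ℕ) (C : Submodule k H) : Prop :=
  ∃ e : Fin n → Fin n → H, IsMultMatrix k H n C e

end Coalg

section Dual

variable (H : Type*) [Ring H] [Algebra k H] [FiniteDimensional k H]

/-- The comultiplication on the dual of a finite-dimensional algebra:
the dual map of the multiplication, composed with the canonical identification
`(H ⊗ H)* ≃ H* ⊗ H*`. -/
noncomputable def dualComul :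
    Module.Dual k H →ₗ[k] Module.Dual k H ⊗[k] Module.Dual k H :=
  (TensorProduct.dualDistribEquiv k H H).symm.toLinearMap ∘ₗ
    (LinearMap.mul' k H).dualMap

/-- A finite-dimensional Hopf algebra is copointed if its dual is pointed. -/
def IsCopointed : Prop := IsPointedWrt k (dualComul k H)

/-- The grouplike elements of the dual Hopf algebra. -/
def dualGrouplikes : Set (Module.Dual k H) :=
  {f : Module.Dual k H | IsGrouplikeWrt k (dualComul k H) f}

end Dual

section Taft

variable (p : ℕ) (q : k)

/-- `B` is (isomorphic to) the Taft Hopf algebra `T_q` of dimension `p²`: `q` is a primitive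
`p`-th root of unity, `B` has dimension `p²` and is generated as an algebra by a grouplike `g`
and a `(1,g)`-skew-primitive `x` with `g^p = 1`, `x^p = 0` and `g x = q x g`. -/
def IsTaftAlgebra (B : Type*) [Ring B] [Bialgebra k B] : Prop :=
  IsPrimitiveRoot q p ∧ Module.finrank k B = p ^ 2 ∧
  ∃ g x : B,
    IsGrouplikeWrt k (comulL k B) g ∧
    CoalgebraStruct.comul (R := k) x = x ⊗ₜ[k] (1 : B) + g ⊗ₜ[k] x ∧
    g ^ p = 1 ∧ x ^ p = 0 ∧ g * x = q • (x * g) ∧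
    Algebra.adjoin k {g, x} = (⊤ : Subalgebra k B)

variable {H : Type*} [Ring H] [Bialgebra k H]

/-- The subalgebra `T` of `H` is a sub-Hopf algebra isomorphic to the Taft algebra `T_q` of
dimension `p²`, generated by a grouplike `g` and a `(1,g)`-skew-primitive `x` satisfying the
Taft relations. -/
def IsTaftSubalgebra (T : Subalgebra k H) : Prop :=
  IsPrimitiveRoot q p ∧ Module.finrank k T = p ^ 2 ∧
  ∃ g x : H,
    IsGrouplikeWrt k (comulL k H) g ∧
    CoalgebraStruct.comul (R := k) x = x ⊗ₜ[k] (1 : H) + g ⊗ₜ[k] x ∧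
    g ^ p = 1 ∧ x ^ p = 0 ∧ g * x = q • (x * g) ∧
    Algebra.adjoin k {g, x} = T

/-- The right coinvariants `H^{co π}` of a linear map `π : H → B` on a bialgebra `H`:
elements `h` with `(id ⊗ π)(Δ h) = h ⊗ 1`. -/
def rightCoinvariants {B : Type*} [Ring B] [Bialgebra k B] (π : H →ₗ[k] B) : Set H :=
  {h : H | (TensorProduct.map LinearMap.id π) (CoalgebraStruct.comul (R := k) h)
      = h ⊗ₜ[k] (1 : B)}

end Taft

end HopfClass

namespace ConvAux

section Peirce

variable {k : Type*} [Field k] {A : Type*} [Ring A] [Algebra k A] {ι : Type*} [Fintype ι]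
  [DecidableEq ι] {d : ι → ℕ}

/-- The matrix unit `E_ij` of the block `b`. -/
def blockUnit (k : Type*) [Field k] {ι : Type*} [DecidableEq ι] {d : ι → ℕ} (b : ι)
    (i j : Fin (d b)) : Π b, Matrix (Fin (d b)) (Fin (d b)) k :=
  Pi.single b (Matrix.single i j 1)

omit [Fintype ι] in
lemma blockUnit_mul (b : ι) (i j l : Fin (d b)) :
    blockUnit k b i j * blockUnit k b j l = blockUnit k b i l := by
  simp [blockUnit, ← Pi.single_mul]

omit [Fintype ι] in
lemma blockUnit_mul_of_ne {p q : Σ b, Fin (d b)} (h : p ≠ q) :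
    blockUnit k p.1 p.2 p.2 * blockUnit k q.1 q.2 q.2 = 0 := by
  obtain ⟨b, i⟩ := p
  obtain ⟨c, j⟩ := q
  by_cases hbc : b = c
  · subst hbc
    have hij : i ≠ j := fun h' => h (by rw [h'])
    simp [blockUnit, ← Pi.single_mul, hij]
  · ext x : 1
    rw [Pi.mul_apply]
    by_cases hx : x = b
    · subst hx
      simp [blockUnit, hbc]
    · simp [blockUnit, hx]

lemma completeOrthogonalIdempotents_blockUnit :
    CompleteOrthogonalIdempotents
      (fun p : Σ b, Fin (d b) => blockUnit k p.1 p.2 p.2) := by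
  rw [CompleteOrthogonalIdempotents.iff_ortho_complete]
  refine ⟨fun p q h => blockUnit_mul_of_ne h, ?_⟩
  rw [Fintype.sum_sigma]
  simp only [blockUnit]
  have (b : ι) : ∑ i : Fin (d b), (Pi.single b (Matrix.single i i (1 : k)) :
      Π b, Matrix (Fin (d b)) (Fin (d b)) k) = Pi.single b 1 := by
    rw [← Matrix.sum_single_one]
    exact (map_sum (AddMonoidHom.single (fun b => Matrix (Fin (d b)) (Fin (d b)) k) b) _ _).symm
  simp only [this]
  exact Finset.univ_sum_single 1

variable {π : A →ₐ[k] Π b, Matrix (Fin (d b)) (Fin (d b)) k}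

lemma exists_lift_blockUnit (hπ : Function.Surjective π) (hJ : ∀ x, π x = 0 → IsNilpotent x) :
    ∃ e : (Σ b, Fin (d b)) → A, CompleteOrthogonalIdempotents e ∧
      ∀ p, π (e p) = blockUnit k p.1 p.2 p.2 := by
  obtain ⟨e, he, h⟩ := CompleteOrthogonalIdempotents.lift_of_isNilpotent_ker π.toRingHom
    (fun x hx => hJ x hx) (completeOrthogonalIdempotents_blockUnit (k := k) (d := d))
    (fun p => hπ _)
  exact ⟨e, he, fun p => congrFun h p⟩

lemma eq_zero_of_one_add_mul {w z : A} (hw : IsNilpotent w) (h : (1 + w) * z = 0) : z = 0 :=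
  (hw.isUnit_one_add.mul_right_eq_zero).mp h

lemma eq_zero_of_mul_one_add {w z : A} (hw : IsNilpotent w) (h : z * (1 + w) = 0) : z = 0 :=
  (hw.isUnit_one_add.mul_left_eq_zero).mp h

variable (π) in
/-- The Peirce component `e p * J * e q` of the kernel `J` of `π` is nonzero. -/
def Linked (e : (Σ b, Fin (d b)) → A) (p q : Σ b, Fin (d b)) : Prop :=
  ∃ x, π x = 0 ∧ e p * x * e q ≠ 0

variable {e : (Σ b, Fin (d b)) → A}

lemma Linked.left (hπ : Function.Surjective π) (hJ : ∀ x, π x = 0 → IsNilpotent x)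
    (he : CompleteOrthogonalIdempotents e) (hπe : ∀ p, π (e p) = blockUnit k p.1 p.2 p.2)
    {b : ι} {i : Fin (d b)} {q} (h : Linked π e ⟨b, i⟩ q) (i' : Fin (d b)) :
    Linked π e ⟨b, i'⟩ q := by
  obtain ⟨x, hx, hne⟩ := h
  obtain ⟨a, ha⟩ := hπ (blockUnit k b i i')
  obtain ⟨a', ha'⟩ := hπ (blockUnit k b i' i)
  refine ⟨a' * e ⟨b, i⟩ * x, by simp [hx], fun h0 => hne ?_⟩
  have hid := (he.idem ⟨b, i⟩).eq
  set E := e ⟨b, i⟩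
  set E' := e ⟨b, i'⟩
  refine eq_zero_of_one_add_mul (w := E * a * E' * a' * E - E) (hJ _ ?_) ?_
  · simp only [map_sub, map_mul, ha, ha', hπe, E, E', blockUnit_mul, sub_self]
  · calc (1 + (E * a * E' * a' * E - E)) * (E * x * e q)
        = E * x * e q + E * a * (E' * (a' * (E * E) * x) * e q) - E * E * x * e q := by noncomm_ring
      _ = 0 := by rw [hid, h0]; simp

lemma Linked.right (hπ : Function.Surjective π) (hJ : ∀ x, π x = 0 → IsNilpotent x)
    (he : CompleteOrthogonalIdempotents e) (hπe : ∀ p, π (e p) = blockUnit k p.1 p.2 p.2)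
    {b : ι} {i : Fin (d b)} {q} (h : Linked π e q ⟨b, i⟩) (i' : Fin (d b)) :
    Linked π e q ⟨b, i'⟩ := by
  obtain ⟨x, hx, hne⟩ := h
  obtain ⟨a, ha⟩ := hπ (blockUnit k b i i')
  obtain ⟨a', ha'⟩ := hπ (blockUnit k b i' i)
  refine ⟨x * e ⟨b, i⟩ * a, by simp [hx], fun h0 => hne ?_⟩
  have hid := (he.idem ⟨b, i⟩).eq
  set E := e ⟨b, i⟩
  set E' := e ⟨b, i'⟩
  refine eq_zero_of_mul_one_add (w := E * a * E' * a' * E - E) (hJ _ ?_) ?_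
  · simp only [map_sub, map_mul, ha, ha', hπe, E, E', blockUnit_mul, sub_self]
  · calc (e q * x * E) * (1 + (E * a * E' * a' * E - E))
        = e q * x * E + (e q * (x * (E * E) * a) * E') * a' * E - e q * x * (E * E) := by
          noncomm_ring
      _ = 0 := by rw [hid, h0]; simp

variable [FiniteDimensional k A]

open Classical in
lemma card_linked_le (he : CompleteOrthogonalIdempotents e) :
    Fintype.card {r : (Σ b, Fin (d b)) × (Σ b, Fin (d b)) // Linked π e r.1 r.2} ≤
      Module.finrank k (LinearMap.ker π.toLinearMap) := by
  have hx : ∀ r : {r : (Σ b, Fin (d b)) × (Σ b, Fin (d b)) // Linked π e r.1 r.2},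
    ∃ x, π x = 0 ∧ e r.1.1 * x * e r.1.2 ≠ 0 := fun r => r.2
  choose x hx0 hxne using hx
  have hli : LinearIndependent k (fun r : {r : (Σ b, Fin (d b)) × (Σ b, Fin (d b)) //
      Linked π e r.1 r.2} => (⟨e r.1.1 * x r * e r.1.2, by simp [hx0]⟩ :
        LinearMap.ker π.toLinearMap)) := by
    rw [Fintype.linearIndependent_iff]
    intro c hc r
    have h1 := congrArg (fun z => e r.1.1 * z * e r.1.2) (congrArg Subtype.val hc)
    simp only [AddSubmonoidClass.coe_finsetSum, Submodule.coe_smul, Finset.mul_sum,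
      Finset.sum_mul, ZeroMemClass.coe_zero, mul_zero, zero_mul] at h1
    rw [Finset.sum_eq_single r] at h1
    · have h2 : e r.1.1 * c r • (e r.1.1 * x r * e r.1.2) * e r.1.2 =
          c r • (e r.1.1 * x r * e r.1.2) := by
        rw [mul_smul_comm, smul_mul_assoc]
        congr 1
        calc _ = (e r.1.1 * e r.1.1) * x r * (e r.1.2 * e r.1.2) := by noncomm_ring
          _ = _ := by rw [(he.idem _).eq, (he.idem _).eq]
      rw [h2] at h1
      exact (smul_eq_zero.mp h1).resolve_right (hxne r)
    · intro s _ hs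
      rw [mul_smul_comm, smul_mul_assoc]
      have : e r.1.1 * (e s.1.1 * x s * e s.1.2) * e r.1.2 =
        (e r.1.1 * e s.1.1) * x s * (e s.1.2 * e r.1.2) := by noncomm_ring
      rw [this, he.mul_eq, he.mul_eq]
      by_cases h1 : r.1.1 = s.1.1
      · by_cases h2 : s.1.2 = r.1.2
        · exact absurd (Subtype.ext (Prod.ext h1.symm h2)) hs
        · simp [h2]
      · simp [h1]
    · simp
  exact hli.fintype_card_le_finrank

open Classical in
lemma sum_linked_le (hπ : Function.Surjective π) (hJ : ∀ x, π x = 0 → IsNilpotent x)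
    (he : CompleteOrthogonalIdempotents e) (hπe : ∀ p, π (e p) = blockUnit k p.1 p.2 p.2) :
    ∑ b, ∑ c, (if ∃ i j, Linked π e ⟨b, i⟩ ⟨c, j⟩ then d b * d c else 0) ≤
      Module.finrank k (LinearMap.ker π.toLinearMap) := by
  refine le_trans (le_of_eq ?_) (card_linked_le (π := π) he)
  have hblock (b c) (i : Fin (d b)) (j : Fin (d c)) : Linked π e ⟨b, i⟩ ⟨c, j⟩ ↔
      ∃ i j, Linked π e ⟨b, i⟩ ⟨c, j⟩ :=
    ⟨fun h => ⟨i, j, h⟩, fun ⟨_, _, h⟩ =>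
      (h.left hπ hJ he hπe i).right hπ hJ he hπe j⟩
  rw [Fintype.card_subtype, Finset.card_filter, Fintype.sum_prod_type, Fintype.sum_sigma]
  refine Finset.sum_congr rfl fun b _ => ?_
  simp only [Fintype.sum_sigma]
  rw [Finset.sum_comm]
  refine Finset.sum_congr rfl fun c _ => ?_
  by_cases h : ∃ i j, Linked π e ⟨b, i⟩ ⟨c, j⟩
  · rw [if_pos h]
    simp only [fun i j => (hblock b c i j).2 h]
    simp
  · rw [if_neg h]
    exact (Finset.sum_eq_zero fun i _ => Finset.sum_eq_zero fun j _ =>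
      if_neg fun h' => h ⟨i, j, h'⟩).symm

end Peirce

section Quiver

variable {k : Type*} [Field k] {A : Type*} [Ring A] [Algebra k A] {G Q : Type*} [Fintype G]
  [Fintype Q] {E : G ⊕ Q → A} {J : Submodule k A} {χ : G → A →ₐ[k] k}

omit [Fintype G] [Fintype Q] in
lemma mul_mul_mem_sq
    (hχJ : ∀ g, ∀ x ∈ J, χ g x = 0)
    (hχl : ∀ g a, E (.inl g) * a - χ g a • E (.inl g) ∈ J)
    (hχr : ∀ g a, a * E (.inl g) - χ g a • E (.inl g) ∈ J)
    (hN : ∀ g h, ∀ θ : A →ₗ[k] k, (∀ a b, θ (a * b) = χ g a * θ b + θ a * χ h b) →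
      ∀ x ∈ J, θ x = 0) (g h : G) {x : A} (hx : x ∈ J) :
    E (.inl g) * x * E (.inl h) ∈ J * J := by
  by_contra hmem
  obtain ⟨θ, hθ1, hθ2⟩ := Submodule.exists_le_ker_of_notMem (K := k) hmem
  set g' := E (.inl g) with hg'
  set h' := E (.inl h) with hh'
  let θ1 : A →ₗ[k] k := θ ∘ₗ LinearMap.mulRight k h' ∘ₗ LinearMap.mulLeft k g'
  have hθ1a (a : A) : θ1 a = θ (g' * a * h') := rfl
  have hmul (a b : A) : θ1 (a * b) =
      χ g a * θ1 b + θ1 a * χ h b - χ g a * χ h b * θ (g' * h') := by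
    have h1 : θ ((g' * a - χ g a • g') * (b * h' - χ h b • h')) = 0 :=
      hθ2 (Submodule.mul_mem_mul (hχl g a) (hχr h b))
    have h2 : (g' * a - χ g a • g') * (b * h' - χ h b • h') =
        g' * (a * b) * h' - χ h b • (g' * a * h') - χ g a • (g' * b * h')
          + (χ g a * χ h b) • (g' * h') := by
      simp only [mul_sub, sub_mul, smul_mul_assoc, mul_smul_comm, mul_assoc, smul_sub, mul_smul]
      rw [smul_comm (χ h b) (χ g a)]
      abel
    rw [h2] at h1
    simp only [map_add, map_sub, map_smul, smul_eq_mul] at h1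
    simp only [hθ1a]
    linear_combination h1
  refine hθ1 ?_
  have := hN g h (θ1 - θ (g' * h') • (χ g).toLinearMap) (fun a b => ?_) x hx
  · simpa [hχJ g x hx, hθ1a] using this
  · simp only [LinearMap.sub_apply, LinearMap.smul_apply, AlgHom.toLinearMap_apply, smul_eq_mul,
      hmul, map_mul]
    ring

lemma exists_arrow_of_source (hE : ∀ p, E p * E p = E p) (hsum : ∑ p, E p = 1)
    (hJl : ∀ a, ∀ x ∈ J, a * x ∈ J) (hnil : ∃ m, J ^ m = ⊥)
    (hsq : ∀ g h, ∀ x ∈ J, E (.inl g) * x * E (.inl h) ∈ J * J) (g : G)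
    (hI : ∃ h, ∃ x ∈ J, E (.inl g) * x * E (.inl h) ≠ 0) :
    ∃ q, ∃ x ∈ J, E (.inl g) * x * E (.inr q) ≠ 0 := by
  by_contra! hcon
  have key (m : ℕ) : ∀ x ∈ J, E (.inl g) * x ∈ J ^ (m + 1) := by
    induction m with
    | zero => intro x hx; simpa using hJl _ x hx
    | succ m ih =>
      have h1 : J * J ≤ (J ^ (m + 1 + 1)).comap (LinearMap.mulLeft k (E (.inl g))) := by
        rw [Submodule.mul_le]
        intro y hy z hz
        rw [Submodule.mem_comap, LinearMap.mulLeft_apply, ← mul_assoc, pow_succ]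
        exact Submodule.mul_mem_mul (ih y hy) hz
      intro x hx
      rw [← mul_one (E _ * x), ← hsum, Finset.mul_sum, Fintype.sum_sum_type]
      refine Submodule.add_mem _ (Submodule.sum_mem _ fun h _ => ?_)
        (Submodule.sum_mem _ fun q _ => ?_)
      · have := h1 (hsq g h x hx)
        rwa [Submodule.mem_comap, LinearMap.mulLeft_apply, ← mul_assoc, ← mul_assoc, hE] at this
      · rw [hcon q x hx]
        exact Submodule.zero_mem _
  obtain ⟨m, hm⟩ := hnil
  obtain ⟨h, x, hx, hne⟩ := hI
  refine hne ?_
  have := key m x hx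
  rw [pow_succ, hm, Submodule.bot_mul, Submodule.mem_bot] at this
  rw [this, zero_mul]

lemma exists_arrow_of_target (hE : ∀ p, E p * E p = E p) (hsum : ∑ p, E p = 1)
    (hJr : ∀ a, ∀ x ∈ J, x * a ∈ J) (hnil : ∃ m, J ^ m = ⊥)
    (hsq : ∀ g h, ∀ x ∈ J, E (.inl g) * x * E (.inl h) ∈ J * J) (h : G)
    (hI : ∃ g, ∃ x ∈ J, E (.inl g) * x * E (.inl h) ≠ 0) :
    ∃ q, ∃ x ∈ J, E (.inr q) * x * E (.inl h) ≠ 0 := by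
  by_contra! hcon
  have key (m : ℕ) : ∀ x ∈ J, x * E (.inl h) ∈ J ^ (m + 1) := by
    induction m with
    | zero => intro x hx; simpa using hJr _ x hx
    | succ m ih =>
      have h1 : J * J ≤ (J ^ (m + 1 + 1)).comap (LinearMap.mulRight k (E (.inl h))) := by
        rw [Submodule.mul_le]
        intro y hy z hz
        rw [Submodule.mem_comap, LinearMap.mulRight_apply, mul_assoc, pow_succ']
        exact Submodule.mul_mem_mul hy (ih z hz)
      intro x hx
      rw [← one_mul (x * E _), ← hsum, Finset.sum_mul, Fintype.sum_sum_type]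
      refine Submodule.add_mem _ (Submodule.sum_mem _ fun g _ => ?_)
        (Submodule.sum_mem _ fun q _ => ?_)
      · have := h1 (hsq g h x hx)
        rwa [Submodule.mem_comap, LinearMap.mulRight_apply, mul_assoc, hE, mul_assoc] at this
      · rw [← mul_assoc, hcon q x hx]
        exact Submodule.zero_mem _
  obtain ⟨m, hm⟩ := hnil
  obtain ⟨g, x, hx, hne⟩ := hI
  refine hne ?_
  have := key m x hx
  rw [pow_succ, hm, Submodule.bot_mul, Submodule.mem_bot] at this
  rw [mul_assoc, this, mul_zero]

lemma exists_arrow_inr_inr (hE : ∀ p, E p * E p = E p)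
    (hE0 : ∀ q g, E (.inr q) * E (.inl g) = 0) (hsum : ∑ p, E p = 1)
    (hJl : ∀ a, ∀ x ∈ J, a * x ∈ J) (hJr : ∀ a, ∀ x ∈ J, x * a ∈ J)
    (hnil : ∃ m, J ^ m = ⊥)
    (hχr : ∀ g a, a * E (.inl g) - χ g a • E (.inl g) ∈ J)
    (hI : ∀ g x, (∀ a, a * x = χ g a • x) → ∃ h, x = x * E (.inl h))
    (hex : ∃ g q, ∃ x ∈ J, E (.inl g) * x * E (.inr q) ≠ 0) :
    ∃ p q, ∃ x ∈ J, E (.inr p) * x * E (.inr q) ≠ 0 := by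
  by_contra! hcon
  obtain ⟨m₀, hm₀⟩ := hnil
  have hno : ∀ m, ∀ g q, ∀ x ∈ J ^ (m + 1), E (.inl g) * x * E (.inr q) = 0 := by
    suffices ∀ r m, m₀ ≤ m + r → ∀ g q, ∀ x ∈ J ^ (m + 1), E (.inl g) * x * E (.inr q) = 0 from
      fun m => this m₀ m (by omega)
    intro r
    induction r with
    | zero =>
      intro m hm g q x hx
      obtain ⟨s, rfl⟩ := Nat.exists_eq_add_of_le hm
      have : x = 0 := by
        have h1 : J ^ (m₀ + s + 1) = ⊥ := by rw [add_assoc, pow_add, hm₀, Submodule.bot_mul]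
        rwa [h1, Submodule.mem_bot] at hx
      rw [this, mul_zero, zero_mul]
    | succ r ih =>
      intro m hm g q x hx
      have ih := ih (m + 1) (by omega)
      set z := E (.inl g) * x * E (.inr q) with hz
      have hgz : E (.inl g) * z = z := by rw [hz, ← mul_assoc, ← mul_assoc, hE]
      have hzq : z * E (.inr q) = z := by rw [hz, mul_assoc, hE]
      have hzJ : z ∈ J ^ (m + 1) := by
        have hl : J ^ (m + 1) ≤ (J ^ (m + 1)).comap (LinearMap.mulLeft k (E (.inl g))) := by
          conv_lhs => rw [pow_succ']
          rw [Submodule.mul_le]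
          intro u hu v hv
          rw [Submodule.mem_comap, LinearMap.mulLeft_apply, ← mul_assoc, pow_succ']
          exact Submodule.mul_mem_mul (hJl _ u hu) hv
        have hr : J ^ (m + 1) ≤ (J ^ (m + 1)).comap (LinearMap.mulRight k (E (.inr q))) := by
          conv_lhs => rw [pow_succ]
          rw [Submodule.mul_le]
          intro u hu v hv
          rw [Submodule.mem_comap, LinearMap.mulRight_apply, mul_assoc, pow_succ]
          exact Submodule.mul_mem_mul hu (hJr _ v hv)
        exact hr (hl hx)
      have hJz : ∀ y ∈ J, y * z = 0 := by
        intro y hy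
        rw [← one_mul (y * z), ← hsum, Finset.sum_mul, Fintype.sum_sum_type]
        have hyz : y * z ∈ J ^ (m + 1 + 1) := by
          rw [pow_succ']
          exact Submodule.mul_mem_mul hy hzJ
        have h1 (p) : E p * (y * z) = E p * (y * z) * E (.inr q) := by
          rw [mul_assoc, mul_assoc y, hzq]
        rw [Finset.sum_eq_zero fun g' _ => ?_, Finset.sum_eq_zero fun p _ => ?_, add_zero]
        · rw [h1, hcon p q _ (hJr _ y hy)]
        · rw [h1, ih g' q _ hyz]
      have haz (a : A) : a * z = χ g a • z := by
        have := hJz _ (hχr g a)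
        rw [sub_mul, mul_assoc, smul_mul_assoc, hgz, sub_eq_zero] at this
        exact this
      obtain ⟨h, hh⟩ := hI g z haz
      rw [hh, ← hzq, mul_assoc, hE0, mul_zero]
  obtain ⟨g, q, x, hx, hne⟩ := hex
  exact hne (hno 0 g q x (by simpa using hx))

end Quiver

section Count

variable {k : Type*} [Field k] {A : Type*} [Ring A] [Algebra k A] [FiniteDimensional k A]
  {G Q : Type*} [Fintype G] [Fintype Q] [DecidableEq G] [DecidableEq Q] {d : Q → ℕ}
  {π : A →ₐ[k] Π b : G ⊕ Q, Matrix (Fin (Sum.elim (fun _ => 1) d b))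
    (Fin (Sum.elim (fun _ => 1) d b)) k} {χ : G → A →ₐ[k] k}

section

variable {ι : Type*} [DecidableEq ι] {m : ι → ℕ} {b : ι} {i : Fin (m b)}

lemma blockUnit_apply_self : blockUnit k b i i b i i = 1 := by
  simp [blockUnit]

lemma blockUnit_mul_of_subsingleton (hs : Subsingleton (Fin (m b)))
    (M : Π b, Matrix (Fin (m b)) (Fin (m b)) k) :
    blockUnit k b i i * M = M b i i • blockUnit k b i i := by
  ext1 c
  rw [Pi.mul_apply, Pi.smul_apply]
  by_cases hc : c = b
  · subst hc
    ext i' j'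
    obtain rfl : i' = i := Subsingleton.elim _ _
    obtain rfl : j' = i' := Subsingleton.elim _ _
    simp [blockUnit]
  · simp [blockUnit, hc]

lemma mul_blockUnit_of_subsingleton (hs : Subsingleton (Fin (m b)))
    (M : Π b, Matrix (Fin (m b)) (Fin (m b)) k) :
    M * blockUnit k b i i = M b i i • blockUnit k b i i := by
  ext1 c
  rw [Pi.mul_apply, Pi.smul_apply]
  by_cases hc : c = b
  · subst hc
    ext i' j'
    obtain rfl : i' = i := Subsingleton.elim _ _
    obtain rfl : j' = i' := Subsingleton.elim _ _
    simp [blockUnit]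
  · simp [blockUnit, hc]

end

lemma le_finrank_ker [Nonempty G] {n : ℕ} (hn : ∀ q, n ≤ d q)
    (hπ : Function.Surjective π) (hJ : ∀ x, π x = 0 → IsNilpotent x)
    (hnil : ∃ m, (LinearMap.ker π.toLinearMap) ^ m = ⊥)
    (hχ : ∀ g a, π a (.inl g) = Matrix.of fun _ _ => χ g a)
    (hN : ∀ g h, ∀ θ : A →ₗ[k] k, (∀ a b, θ (a * b) = χ g a * θ b + θ a * χ h b) →
      ∀ x, π x = 0 → θ x = 0)
    (hl : ∀ g, ∃ h x, x ≠ 0 ∧ π x = 0 ∧ (∀ a, a * x = χ g a • x) ∧ ∀ a, x * a = χ h a • x)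
    (hr : ∀ h, ∃ g x, x ≠ 0 ∧ π x = 0 ∧ (∀ a, a * x = χ g a • x) ∧ ∀ a, x * a = χ h a • x)
    (hlr : ∀ g x, (∀ a, a * x = χ g a • x) → ∃ h, ∀ a, x * a = χ h a • x) :
    (2 * n + 1) * Fintype.card G + n ^ 2 ≤ Module.finrank k (LinearMap.ker π.toLinearMap) := by
  classical
  obtain ⟨e, he, hπe⟩ := exists_lift_blockUnit hπ hJ
  refine le_trans ?_ (sum_linked_le hπ hJ he hπe)
  set J := LinearMap.ker π.toLinearMap with hJdef
  have hmemJ {x : A} : x ∈ J ↔ π x = 0 := by simp [hJdef]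
  let E : G ⊕ (Σ q, Fin (d q)) → A :=
    Sum.elim (fun g => e ⟨.inl g, (0 : Fin 1)⟩) (fun q => e ⟨.inr q.1, q.2⟩)
  have hE : ∀ p, E p * E p = E p := by
    rintro (g | q)
    · exact he.idem _
    · exact he.idem _
  have hE0 (q) (g) : E (.inr q) * E (.inl g) = 0 := he.ortho fun h => by
    simpa using congrArg Sigma.fst h
  have hsum : ∑ p, E p = 1 := by
    rw [← he.complete, Fintype.sum_sigma, Fintype.sum_sum_type, Fintype.sum_sum_type,
      Fintype.sum_sigma]
    congr 1
    refine Finset.sum_congr rfl fun g _ => ?_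
    exact (Fin.sum_univ_one (fun i : Fin 1 => e ⟨.inl g, i⟩)).symm
  have hJl (a x) (hx : x ∈ J) : a * x ∈ J := by rw [hmemJ] at *; simp [hx]
  have hJr (a x) (hx : x ∈ J) : x * a ∈ J := by rw [hmemJ] at *; simp [hx]
  have hχJ (g x) (hx : x ∈ J) : χ g x = 0 := by
    have := hχ g x
    rw [hmemJ.1 hx] at this
    exact (congrFun (congrFun this (0 : Fin 1)) (0 : Fin 1)).symm
  have hχE (g) : χ g (E (.inl g)) = 1 := by
    have h1 := congrFun (congrFun (hχ g (E (.inl g))) (0 : Fin 1)) (0 : Fin 1)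
    refine h1.symm.trans ?_
    change π (e _) _ _ _ = _
    rw [hπe]
    exact blockUnit_apply_self
  have hχl (g a) : E (.inl g) * a - χ g a • E (.inl g) ∈ J := by
    rw [hmemJ, map_sub, map_smul, map_mul, sub_eq_zero]
    change π (e _) * _ = _ • π (e _)
    rw [hπe, blockUnit_mul_of_subsingleton (inferInstanceAs (Subsingleton (Fin 1))), hχ]
    rfl
  have hχr (g a) : a * E (.inl g) - χ g a • E (.inl g) ∈ J := by
    rw [hmemJ, map_sub, map_smul, map_mul, sub_eq_zero]
    change _ * π (e _) = _ • π (e _)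
    rw [hπe, mul_blockUnit_of_subsingleton (inferInstanceAs (Subsingleton (Fin 1))), hχ]
    rfl
  have hsq := fun g h x hx => mul_mul_mem_sq (E := E) hχJ hχl hχr
    (fun g h θ hθ x hx => hN g h θ hθ x (hmemJ.1 hx)) g h (x := x) hx
  have hGl (g) : ∃ h, ∃ x ∈ J, E (.inl g) * x * E (.inl h) ≠ 0 := by
    obtain ⟨h, x, hx0, hx, h1, h2⟩ := hl g
    refine ⟨h, x, hmemJ.2 hx, ?_⟩
    rwa [h1, smul_mul_assoc, h2, hχE, hχE, one_smul, one_smul]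
  have hGr (h) : ∃ g, ∃ x ∈ J, E (.inl g) * x * E (.inl h) ≠ 0 := by
    obtain ⟨g, x, hx0, hx, h1, h2⟩ := hr h
    refine ⟨g, x, hmemJ.2 hx, ?_⟩
    rwa [h1, smul_mul_assoc, h2, hχE, hχE, one_smul, one_smul]
  have hGQ (g) := exists_arrow_of_source hE hsum hJl hnil hsq g (hGl g)
  have hQG (h) := exists_arrow_of_target hE hsum hJr hnil hsq h (hGr h)
  have hQQ := exists_arrow_inr_inr hE hE0 hsum hJl hJr hnil hχr
    (fun g x hx => by
      obtain ⟨h, hh⟩ := hlr g x hx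
      exact ⟨h, by rw [hh, hχE, one_smul]⟩) ⟨Classical.arbitrary G, hGQ _⟩
  let w (b c : G ⊕ Q) : ℕ := if ∃ i j, Linked π e ⟨b, i⟩ ⟨c, j⟩ then
    Sum.elim (fun _ => 1) d b * Sum.elim (fun _ => 1) d c else 0
  have hw (b c i j) (h : Linked π e ⟨b, i⟩ ⟨c, j⟩) :
    w b c = Sum.elim (fun _ => 1) d b * Sum.elim (fun _ => 1) d c := if_pos ⟨i, j, h⟩
  have h1 : Fintype.card G ≤ ∑ g, ∑ h, w (.inl g) (.inl h) := by
    rw [Fintype.card_eq_sum_ones]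
    refine Finset.sum_le_sum fun g _ => ?_
    obtain ⟨h, x, hx, hne⟩ := hGl g
    refine le_trans (le_of_eq ?_) (Finset.single_le_sum (fun _ _ => Nat.zero_le _)
      (Finset.mem_univ h))
    rw [hw (.inl g) (.inl h) (0 : Fin 1) (0 : Fin 1) ⟨x, hmemJ.1 hx, hne⟩]
    rfl
  have h2 : Fintype.card G * n ≤ ∑ g, ∑ q, w (.inl g) (.inr q) := by
    rw [Fintype.card_eq_sum_ones, Finset.sum_mul]
    refine Finset.sum_le_sum fun g _ => ?_
    obtain ⟨q, x, hx, hne⟩ := hGQ g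
    refine le_trans ?_ (Finset.single_le_sum (fun _ _ => Nat.zero_le _) (Finset.mem_univ q.1))
    rw [hw (.inl g) (.inr q.1) (0 : Fin 1) q.2 ⟨x, hmemJ.1 hx, hne⟩]
    exact Nat.mul_le_mul le_rfl (hn _)
  have h3 : Fintype.card G * n ≤ ∑ q, ∑ g, w (.inr q) (.inl g) := by
    rw [Finset.sum_comm, Fintype.card_eq_sum_ones, Finset.sum_mul]
    refine Finset.sum_le_sum fun g _ => ?_
    obtain ⟨q, x, hx, hne⟩ := hQG g
    refine le_trans ?_ (Finset.single_le_sum (fun _ _ => Nat.zero_le _) (Finset.mem_univ q.1))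
    rw [hw (.inr q.1) (.inl g) q.2 (0 : Fin 1) ⟨x, hmemJ.1 hx, hne⟩, mul_comm]
    exact Nat.mul_le_mul (hn _) le_rfl
  have h4 : n * n ≤ ∑ p, ∑ q, w (.inr p) (.inr q) := by
    obtain ⟨p, q, x, hx, hne⟩ := hQQ
    refine le_trans ?_ (Finset.single_le_sum (fun _ _ => Nat.zero_le _) (Finset.mem_univ p.1))
    refine le_trans ?_ (Finset.single_le_sum (fun _ _ => Nat.zero_le _) (Finset.mem_univ q.1))
    rw [hw (.inr p.1) (.inr q.1) p.2 q.2 ⟨x, hmemJ.1 hx, hne⟩]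
    exact Nat.mul_le_mul (hn _) (hn _)
  change _ ≤ ∑ b, ∑ c, w b c
  simp only [Fintype.sum_sum_type, Finset.sum_add_distrib]
  linarith

end Count

open WithConv Coalgebra HopfAlgebra

variable {k : Type*} [Field k] {H : Type*} [Ring H] [HopfAlgebra k H]

lemma algHom_comp_mul {C A B : Type*} [AddCommGroup C] [Module k C] [Coalgebra k C]
    [Ring A] [Algebra k A] [Ring B] [Algebra k B] (φ : A →ₐ[k] B)
    (f g : WithConv (C →ₗ[k] A)) :
    toConv (φ.toLinearMap ∘ₗ (f * g).ofConv) =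
      toConv (φ.toLinearMap ∘ₗ f.ofConv) * toConv (φ.toLinearMap ∘ₗ g.ofConv) := by
  rw [LinearMap.algHom_comp_convMul_distrib]

variable (k H) in
/-- The map `h ↦ h ⊗ 1` in the convolution algebra. -/
noncomputable def inl : WithConv (H →ₗ[k] H ⊗[k] H) :=
  toConv (Algebra.TensorProduct.includeLeft : H →ₐ[k] H ⊗[k] H).toLinearMap

variable (k H) in
/-- The map `h ↦ 1 ⊗ h` in the convolution algebra. -/
noncomputable def inr : WithConv (H →ₗ[k] H ⊗[k] H) :=
  toConv (Algebra.TensorProduct.includeRight : H →ₐ[k] H ⊗[k] H).toLinearMap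

lemma inl_mul_inr : inl k H * inr k H = toConv (comul : H →ₗ[k] H ⊗[k] H) := by
  ext x
  rw [(ℛ k x).convMul_apply]
  simp [inl, inr, (ℛ k x).eq]

lemma inr_mul_inrS : inr k H *
    toConv ((Algebra.TensorProduct.includeRight : H →ₐ[k] H ⊗[k] H).toLinearMap
      ∘ₗ antipode k) = 1 := by
  have := algHom_comp_mul (Algebra.TensorProduct.includeRight : H →ₐ[k] H ⊗[k] H)
    (toConv LinearMap.id) (toConv (antipode k))
  rw [LinearMap.id_mul_antipode] at this
  simp only [LinearMap.comp_id] at this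
  rw [inr, ← this]
  ext x
  simp [Algebra.algebraMap_eq_smul_one, Algebra.TensorProduct.one_def]

lemma inl_mul_inlS : inl k H *
    toConv ((Algebra.TensorProduct.includeLeft : H →ₐ[k] H ⊗[k] H).toLinearMap
      ∘ₗ antipode k) = 1 := by
  have := algHom_comp_mul (Algebra.TensorProduct.includeLeft : H →ₐ[k] H ⊗[k] H)
    (toConv LinearMap.id) (toConv (antipode k))
  rw [LinearMap.id_mul_antipode] at this
  simp only [LinearMap.comp_id] at this
  rw [inl, ← this]
  ext x
  simp [Algebra.algebraMap_eq_smul_one, Algebra.TensorProduct.one_def]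

/-- `Δ ∘ S` in the convolution algebra. -/
lemma comul_antipode : toConv ((comul : H →ₗ[k] H ⊗[k] H) ∘ₗ antipode k) =
    toConv ((Algebra.TensorProduct.includeRight : H →ₐ[k] H ⊗[k] H).toLinearMap ∘ₗ antipode k) *
    toConv ((Algebra.TensorProduct.includeLeft : H →ₐ[k] H ⊗[k] H).toLinearMap ∘ₗ antipode k) := by
  have h1 : toConv ((comul : H →ₗ[k] H ⊗[k] H) ∘ₗ antipode k) *
      toConv (comul : H →ₗ[k] H ⊗[k] H) = 1 := by
    have := algHom_comp_mul (Bialgebra.comulAlgHom k H)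
      (toConv (antipode k)) (toConv LinearMap.id)
    rw [LinearMap.antipode_mul_id] at this
    simp only [LinearMap.comp_id] at this
    refine Eq.trans ?_ (this.symm.trans ?_)
    · rfl
    · ext x
      simp
  refine left_inv_eq_right_inv h1 ?_
  rw [← inl_mul_inr, mul_assoc, ← mul_assoc (inr k H), inr_mul_inrS, one_mul, inl_mul_inlS]

lemma inr_mul_comul_antipode :
    inr k H * toConv ((comul : H →ₗ[k] H ⊗[k] H) ∘ₗ antipode k) =
    toConv ((Algebra.TensorProduct.includeLeft : H →ₐ[k] H ⊗[k] H).toLinearMap ∘ₗ antipode k) := by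
  rw [comul_antipode, ← mul_assoc, inr_mul_inrS, one_mul]

/-- Contraction of the left leg. -/
noncomputable def contrL (b : H →ₗ[k] k) : H ⊗[k] H →ₗ[k] H :=
  (TensorProduct.lid k H).toLinearMap ∘ₗ b.rTensor H

/-- Contraction of the right leg. -/
noncomputable def contrR (b : H →ₗ[k] k) : H ⊗[k] H →ₗ[k] H :=
  (TensorProduct.rid k H).toLinearMap ∘ₗ b.lTensor H

@[simp] lemma contrL_tmul (b : H →ₗ[k] k) (x y : H) : contrL b (x ⊗ₜ[k] y) = b x • y := by
  simp [contrL]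

@[simp] lemma contrR_tmul (b : H →ₗ[k] k) (x y : H) : contrR b (x ⊗ₜ[k] y) = b y • x := by
  simp [contrR]

lemma conv_apply_contrL (a b : WithConv (H →ₗ[k] k)) (x : H) :
    (a * b) x = b (contrL a.ofConv (comul x)) := by
  rw [(ℛ k x).convMul_apply, ← (ℛ k x).eq]
  simp

lemma conv_apply_contrR (a b : WithConv (H →ₗ[k] k)) (x : H) :
    (a * b) x = a (contrR b.ofConv (comul x)) := by
  rw [(ℛ k x).convMul_apply, ← (ℛ k x).eq]
  simp [mul_comm]

lemma eq_of_dual {x y : H} (h : ∀ f : H →ₗ[k] k, f x = f y) : x = y := by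
  rw [← sub_eq_zero, ← Module.forall_dual_apply_eq_zero_iff k]
  intro f
  simp [h]

lemma comp_finset_sum {ι : Type*} {M N P : Type*} [AddCommGroup M] [AddCommGroup N] [AddCommGroup P]
    [Module k M] [Module k N] [Module k P] (s : Finset ι) (φ : N →ₗ[k] P) (F : ι → M →ₗ[k] N) :
    φ ∘ₗ (∑ i ∈ s, F i) = ∑ i ∈ s, φ ∘ₗ F i := by
  ext; simp

/-- Left integrals relative to `g` in the dual algebra. -/
def IsInt (g : H) (l : WithConv (H →ₗ[k] k)) : Prop :=
  ∀ b : WithConv (H →ₗ[k] k), b * l = b g • l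

lemma isInt_iff {g : H} {l : WithConv (H →ₗ[k] k)} :
    IsInt g l ↔ ∀ x, contrR l.ofConv (comul x) = l x • g := by
  constructor
  · intro h x
    refine eq_of_dual (k := k) fun f => ?_
    have := congrArg (fun z => z.ofConv x) (h (toConv f))
    simp only [conv_apply_contrR] at this
    rw [this]
    simp [mul_comm]
  · intro h b
    ext x
    rw [conv_apply_contrR, h]
    simp [mul_comm]

lemma contrL_comp_mul_inr (b : H →ₗ[k] k) (F : WithConv (H →ₗ[k] H ⊗[k] H))
    (G : WithConv (H →ₗ[k] H)) :
    toConv (contrL b ∘ₗ (F * toConv ((Algebra.TensorProduct.includeRight :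
      H →ₐ[k] H ⊗[k] H).toLinearMap ∘ₗ G.ofConv)).ofConv) =
    toConv (contrL b ∘ₗ F.ofConv) * G := by
  ext x
  rw [(ℛ k x).convMul_apply]
  simp only [LinearMap.comp_apply]
  rw [(ℛ k x).convMul_apply, map_sum]
  refine Finset.sum_congr rfl fun i _ => ?_
  simp only [LinearMap.comp_apply]
  generalize F.ofConv ((ℛ k x).left i) = u
  generalize G ((ℛ k x).right i) = y
  induction u with
  | zero => simp
  | add a b ha hb => simp_all [add_mul]
  | tmul a b => simp

/-- Twist of an endomorphism by a functional. -/
noncomputable def twist (b : H →ₗ[k] k) (V : H →ₗ[k] H) : H →ₗ[k] H :=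
  contrL b ∘ₗ (toConv (comul ∘ₗ V) * inl k H).ofConv

lemma twist_mul_id (b : H →ₗ[k] k) (V : H →ₗ[k] H) :
    toConv (twist b V) * toConv LinearMap.id =
    toConv (contrL b ∘ₗ comul ∘ₗ (toConv V * toConv LinearMap.id).ofConv) := by
  have := contrL_comp_mul_inr b (toConv (comul ∘ₗ V) * inl k H) (toConv LinearMap.id)
  rw [twist, ← this, mul_assoc]
  have h2 := algHom_comp_mul (Bialgebra.comulAlgHom k H) (toConv V) (toConv LinearMap.id)
  have h3 : inl k H * toConv ((Algebra.TensorProduct.includeRight :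
      H →ₐ[k] H ⊗[k] H).toLinearMap ∘ₗ (toConv LinearMap.id : WithConv (H →ₗ[k] H)).ofConv) =
      toConv (comul : H →ₗ[k] H ⊗[k] H) := inl_mul_inr
  rw [h3]
  congr 2
  exact congrArg WithConv.ofConv h2.symm

variable [FiniteDimensional k H]

lemma trace_twist (b : H →ₗ[k] k) (V : H →ₗ[k] H) :
    LinearMap.trace k H (antipode k ∘ₗ twist b V) =
      b 1 • LinearMap.trace k H (antipode k ∘ₗ V) := by
  have rank1 : ∀ (f : H →ₗ[k] k) (y : H),
      LinearMap.trace k H (antipode k ∘ₗ twist b (f.smulRight y))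
      = b 1 • LinearMap.trace k H (antipode k ∘ₗ (f.smulRight y)) := by
    intro f y
    have e1 : antipode k ∘ₗ (f.smulRight y) = f.smulRight (antipode k y) := by
      ext; simp
    rw [e1, LinearMap.trace_smulRight]
    have e2 : antipode k ∘ₗ twist b (f.smulRight y) =
        ∑ i ∈ (ℛ k y).index, LinearMap.smulRight (LinearMap.mul' k k ∘ₗ
          TensorProduct.map f (b ∘ₗ LinearMap.mulLeft k ((ℛ k y).left i)) ∘ₗ comul)
          (antipode k ((ℛ k y).right i)) := by
      ext h
      simp only [twist, LinearMap.comp_apply]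
      rw [(ℛ k h).convMul_apply]
      simp only [LinearMap.coe_sum, Finset.sum_apply, LinearMap.comp_apply,
        LinearMap.smulRight_apply]
      conv_rhs => rw [← (ℛ k h).eq]
      simp only [map_sum, Finset.sum_smul, map_smul]
      rw [Finset.sum_comm]
      refine Finset.sum_congr rfl fun j _ => ?_
      conv_lhs => rw [← (ℛ k y).eq]
      simp only [inl, Finset.smul_sum, Finset.sum_mul, map_sum]
      refine Finset.sum_congr rfl fun i _ => ?_
      simp [smul_smul]
    rw [e2, map_sum]
    simp only [LinearMap.trace_smulRight]
    have e3 := congrArg (fun z => z.ofConv y) (inr_mul_comul_antipode (k := k) (H := H))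
    rw [(ℛ k y).convMul_apply] at e3
    have e4 := congrArg (LinearMap.mul' k k ∘ₗ TensorProduct.map f b) e3
    simp only [map_sum] at e4
    refine Eq.trans (Finset.sum_congr rfl fun i _ => ?_) (e4.trans ?_)
    · simp only [LinearMap.comp_apply, inr, ofConv_toConv]
      generalize (comul (R := k) (antipode k ((ℛ k y).right i))) = u
      induction u with
      | zero => simp
      | add a b ha hb => simp_all [mul_add]
      | tmul a b => simp
    · simp [mul_comm]
  have hV : V = ∑ i, LinearMap.smulRight ((Module.finBasis k H).coord i)
      (V (Module.finBasis k H i)) := by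
    refine (Module.finBasis k H).ext fun j => ?_
    simp [Finsupp.single_apply]
  have hadd : twist b (∑ i, LinearMap.smulRight ((Module.finBasis k H).coord i)
      (V (Module.finBasis k H i))) =
        ∑ i, twist b (LinearMap.smulRight ((Module.finBasis k H).coord i)
      (V (Module.finBasis k H i))) := by
    rw [twist, comp_finset_sum, toConv_sum, Finset.sum_mul, ofConv_sum, comp_finset_sum]
    rfl
  rw [hV, hadd]
  simp only [comp_finset_sum, map_sum, rank1, Finset.smul_sum]

omit [FiniteDimensional k H] in
lemma mul_id_mul_antipode (V : WithConv (H →ₗ[k] H)) :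
    V * toConv LinearMap.id * toConv (antipode k) = V := by
  rw [mul_assoc, LinearMap.id_mul_antipode, mul_one]

omit [FiniteDimensional k H] in
lemma mul_antipode_mul_id (V : WithConv (H →ₗ[k] H)) :
    V * toConv (antipode k) * toConv LinearMap.id = V := by
  rw [mul_assoc, LinearMap.antipode_mul_id, mul_one]

lemma exists_int : ∃ l : WithConv (H →ₗ[k] k), l ≠ 0 ∧ IsInt 1 l := by
  let Q (f : H →ₗ[k] k) (x : H) : H →ₗ[k] H := (toConv (f.smulRight x) * toConv (antipode k)).ofConv
  have hQ (f : H →ₗ[k] k) (b : H →ₗ[k] k) (x : H) :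
      twist b (Q f x) = Q f (contrL b (comul x)) := by
    have h1 := twist_mul_id b (Q f x)
    rw [show toConv (Q f x) = toConv (f.smulRight x) * toConv (antipode k) from rfl,
      mul_antipode_mul_id] at h1
    have h2 := congrArg (fun z => (z * toConv (antipode k)).ofConv) h1
    simp only [mul_id_mul_antipode] at h2
    refine h2.trans ?_
    simp only [Q]
    congr 3
    ext h
    simp
  let L (f : H →ₗ[k] k) : H →ₗ[k] k :=
    { toFun := fun x => LinearMap.trace k H (antipode k ∘ₗ Q f x)
      map_add' := by
        intro x y
        rw [← map_add]; congr 1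
        ext h
        simp only [Q, LinearMap.add_apply, LinearMap.comp_apply, ← map_add]
        congr 1
        simp only [(ℛ k h).convMul_apply, ← Finset.sum_add_distrib]
        simp [add_mul]
      map_smul' := by
        intro c x
        rw [RingHom.id_apply, ← map_smul]; congr 1
        ext h
        simp only [Q, LinearMap.smul_apply, LinearMap.comp_apply, ← map_smul]
        congr 1
        rw [map_smul, (ℛ k h).convMul_apply, (ℛ k h).convMul_apply, Finset.smul_sum]
        simp [smul_comm c] }
  have hL (f) : IsInt 1 (toConv (L f)) := by
    intro b
    ext x
    rw [conv_apply_contrL]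
    change LinearMap.trace k H (antipode k ∘ₗ Q f (contrL b.ofConv (comul x))) =
      b 1 • LinearMap.trace k H (antipode k ∘ₗ Q f x)
    rw [← hQ, trace_twist]
  by_contra! hcon
  have hz (f x) : LinearMap.trace k H (antipode k ∘ₗ Q f x) = 0 := by
    by_contra h
    refine hcon (toConv (L f)) ?_ (hL f)
    intro h0
    exact h (congrArg (fun z => z.ofConv x) h0)
  have hall (V : H →ₗ[k] H) : LinearMap.trace k H (antipode k ∘ₗ V) = 0 := by
    set W := (toConv V * toConv LinearMap.id).ofConv with hW
    have hV : V = ∑ i, Q ((Module.finBasis k H).coord i) (W (Module.finBasis k H i)) := by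
      have h1 : W = ∑ i, LinearMap.smulRight ((Module.finBasis k H).coord i)
          (W (Module.finBasis k H i)) := by
        refine (Module.finBasis k H).ext fun j => ?_
        simp [Finsupp.single_apply]
      have h2 : V = (toConv W * toConv (antipode k)).ofConv := by
        rw [hW, toConv_ofConv, mul_id_mul_antipode]
      rw [h1] at h2
      rw [h2]
      simp [Finset.sum_mul, Q]
    rw [hV]
    simp [comp_finset_sum, hz]
  have hS : (1 : H) = 0 := by
    refine eq_of_dual (k := k) fun f => ?_
    have := hall (f.smulRight 1)
    have e1 : antipode k ∘ₗ (f.smulRight (1 : H)) = f.smulRight (antipode k 1) := by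
      ext; simp
    rw [e1, LinearMap.trace_smulRight] at this
    simpa using this
  have := congrArg (counit (R := k)) hS
  simp at this

omit [FiniteDimensional k H] in
lemma id_mul_cancel {F G : WithConv (H →ₗ[k] H)}
    (h : toConv LinearMap.id * F = toConv LinearMap.id * G) : F = G := by
  have := congrArg (toConv (antipode k) * ·) h
  simpa only [← mul_assoc, LinearMap.antipode_mul_id, one_mul] using this

/-- The map `x ↦ ∑ u₁ l(x u₂)`. -/
noncomputable def slide (l : H →ₗ[k] k) (u : H ⊗[k] H) : H →ₗ[k] H :=
  contrR l ∘ₗ LinearMap.mulRight k u ∘ₗ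
    (Algebra.TensorProduct.includeRight : H →ₐ[k] H ⊗[k] H).toLinearMap

omit [FiniteDimensional k H] in
lemma id_mul_slide (l : H →ₗ[k] k) (u : H ⊗[k] H) :
    toConv LinearMap.id * toConv (slide l u) =
      toConv (contrR l ∘ₗ LinearMap.mulRight k u ∘ₗ comul) := by
  ext x
  rw [(ℛ k x).convMul_apply]
  simp only [LinearMap.comp_apply]
  conv_rhs => rw [← (ℛ k x).eq]
  simp only [map_sum]
  refine Finset.sum_congr rfl fun i _ => ?_
  induction u with
  | zero => simp [slide]
  | add a b ha hb => simp_all [slide, mul_add]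
  | tmul a b => simp [slide]

omit [FiniteDimensional k H] in
lemma id_mul_slide_comul {l : WithConv (H →ₗ[k] k)} (hl : IsInt 1 l) (h : H) :
    toConv LinearMap.id * toConv (slide l.ofConv (comul h)) =
      toConv ((l.ofConv ∘ₗ LinearMap.mulRight k h).smulRight 1) := by
  rw [id_mul_slide]
  ext x
  simp only [LinearMap.comp_apply, LinearMap.mulRight_apply, LinearMap.smulRight_apply]
  rw [← Bialgebra.comul_mul, isInt_iff.mp hl]

omit [FiniteDimensional k H] in
lemma apply_slide (l f : H →ₗ[k] k) (u : H ⊗[k] H) (x : H) :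
    f (slide l u x) = l (x * contrL f u) := by
  induction u with
  | zero => simp [slide]
  | add a b ha hb => simp_all [slide, mul_add]
  | tmul a b => simp [slide, mul_comm]

lemma int_nondeg {l : WithConv (H →ₗ[k] k)} (hl : IsInt 1 l) (hl0 : l ≠ 0) {h : H}
    (hh : ∀ x, l (x * h) = 0) : h = 0 := by
  have h1 : slide l.ofConv (comul h) = 0 := by
    have := id_mul_slide_comul hl h
    rw [show (l.ofConv ∘ₗ LinearMap.mulRight k h).smulRight (1 : H) = 0 by ext x; simp [hh],
      toConv_zero] at this
    exact toConv_injective (id_mul_cancel (this.trans (mul_zero _).symm))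
  have h2 : ∀ V : H →ₗ[k] H, l ((toConv V * toConv LinearMap.id : WithConv (H →ₗ[k] H)) h) = 0 := by
    intro V
    have hV : V = ∑ i, LinearMap.smulRight ((Module.finBasis k H).coord i)
        (V (Module.finBasis k H i)) := by
      refine (Module.finBasis k H).ext fun j => ?_
      simp [Finsupp.single_apply]
    rw [hV, toConv_sum, Finset.sum_mul, ofConv_sum, LinearMap.sum_apply, map_sum]
    refine Finset.sum_eq_zero fun i _ => ?_
    have h3 := apply_slide l.ofConv ((Module.finBasis k H).coord i) (comul h)
      (V (Module.finBasis k H i))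
    rw [h1] at h3
    rw [LinearMap.zero_apply, map_zero] at h3
    rw [h3]
    congr 1
    rw [(ℛ k h).convMul_apply]
    conv_rhs => rw [← (ℛ k h).eq]
    simp [Finset.mul_sum]
  obtain ⟨y, hy⟩ : ∃ y, l y ≠ 0 := by
    by_contra! hc
    exact hl0 (WithConv.ext (LinearMap.ext hc))
  refine eq_of_dual (k := k) fun a => ?_
  have := h2 (toConv (a.smulRight y) * toConv (antipode k)).ofConv
  rw [toConv_ofConv, mul_antipode_mul_id] at this
  simp only [LinearMap.smulRight_apply, map_smul, smul_eq_mul] at this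
  rw [map_zero]
  exact (mul_eq_zero.mp this).resolve_right hy

lemma int_unique {l m : WithConv (H →ₗ[k] k)} (hl : IsInt 1 l) (hl0 : l ≠ 0) (hm : IsInt 1 m) :
    ∃ c : k, m = c • l := by
  let T : H →ₗ[k] (H →ₗ[k] k) := LinearMap.llcomp k H H k l.ofConv ∘ₗ (LinearMap.mul k H).flip
  have hT (h x : H) : T h x = l (x * h) := rfl
  have hinj : Function.Injective T := by
    rw [injective_iff_map_eq_zero]
    intro h hh
    refine int_nondeg hl hl0 fun x => ?_
    rw [← hT, hh, LinearMap.zero_apply]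
  have hsurj : Function.Surjective T :=
    (LinearMap.injective_iff_surjective_of_finrank_eq_finrank
      (Subspace.dual_finrank_eq (K := k) (V := H)).symm).mp hinj
  obtain ⟨h, hh⟩ := hsurj m.ofConv
  have hmx (x : H) : m x = l (x * h) := by rw [← hT, hh]
  have h1 : toConv (slide l.ofConv (comul h)) =
      toConv ((l.ofConv ∘ₗ LinearMap.mulRight k h).smulRight 1) := by
    apply id_mul_cancel
    rw [id_mul_slide_comul hl]
    ext x
    have := isInt_iff.mp hm x
    rw [hmx] at this
    simp only [LinearMap.smulRight_apply, LinearMap.comp_apply, LinearMap.mulRight_apply]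
    rw [← this, (ℛ k x).convMul_apply]
    conv_lhs => rw [← (ℛ k x).eq]
    simp [hmx]
  have h2 (f : H →ₗ[k] k) : contrL f (comul h) = f 1 • h := by
    rw [← sub_eq_zero]
    refine int_nondeg hl hl0 fun x => ?_
    rw [mul_sub, map_sub, ← apply_slide, toConv_injective h1]
    simp [mul_comm]
  have h3 : h = counit (R := k) h • 1 := by
    refine eq_of_dual (k := k) fun f => ?_
    have := congrArg (counit (R := k)) (h2 f)
    rw [← (ℛ k h).eq] at this
    simp only [map_sum, contrL_tmul, map_smul, smul_eq_mul] at this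
    have h4 := congrArg f (sum_counit_smul (R := k) (ℛ k h))
    have h5 := congrArg f (congrArg (TensorProduct.rid k H)
      (Coalgebra.sum_tmul_counit_eq (R := k) (ℛ k h)))
    simp only [map_sum, TensorProduct.rid_tmul, map_smul, smul_eq_mul, one_smul] at h5
    rw [← h5, map_smul, smul_eq_mul, mul_comm, ← this]
    exact Finset.sum_congr rfl fun _ _ => mul_comm _ _
  refine ⟨counit (R := k) h, WithConv.ext (LinearMap.ext fun x => ?_)⟩
  rw [hmx, h3]
  simp

omit [FiniteDimensional k H] in
lemma int_antipode {l : WithConv (H →ₗ[k] k)} (hl : IsInt 1 l) (x : H) :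
    contrR l.ofConv ∘ₗ LinearMap.mulLeft k (comul x) ∘ₗ
      (Algebra.TensorProduct.includeRight : H →ₐ[k] H ⊗[k] H).toLinearMap ∘ₗ antipode k =
    contrL (l.ofConv ∘ₗ LinearMap.mulLeft k x ∘ₗ antipode k) ∘ₗ comul := by
  set K := contrR l.ofConv ∘ₗ LinearMap.mulLeft k (comul x) ∘ₗ
      (Algebra.TensorProduct.includeRight : H →ₐ[k] H ⊗[k] H).toLinearMap ∘ₗ antipode k with hK
  have h1 : toConv K * toConv (antipode k) =
      toConv ((l.ofConv ∘ₗ LinearMap.mulLeft k x ∘ₗ antipode k).smulRight 1) := by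
    ext w
    have h2 := congrArg (fun z => z.ofConv w) (comul_antipode (k := k) (H := H))
    simp only [LinearMap.comp_apply] at h2
    simp only [LinearMap.smulRight_apply, LinearMap.comp_apply, LinearMap.mulLeft_apply]
    rw [← isInt_iff.mp hl, Bialgebra.comul_mul, h2, (ℛ k w).convMul_apply,
      (ℛ k w).convMul_apply, Finset.mul_sum, map_sum]
    refine Finset.sum_congr rfl fun i _ => ?_
    simp only [hK, LinearMap.comp_apply, LinearMap.mulLeft_apply]
    generalize (comul (R := k) x) = u
    induction u with
    | zero => simp
    | add a b ha hb => simp_all [add_mul]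
    | tmul a b => simp
  have h3 := congrArg (· * toConv LinearMap.id) h1
  simp only [mul_antipode_mul_id] at h3
  refine toConv_injective (h3.trans ?_)
  ext w
  rw [(ℛ k w).convMul_apply, LinearMap.comp_apply, ← (ℛ k w).eq]
  simp

lemma eq_top_of_int_one_ne_zero {l : WithConv (H →ₗ[k] k)} (hl : IsInt 1 l) (h1 : l 1 ≠ 0)
    (H0 : Submodule k H)
    (hsub : ∀ x ∈ H0, comul x ∈ LinearMap.range (TensorProduct.map H0.subtype H0.subtype))
    (hnil : ∀ f : WithConv (H →ₗ[k] k), (∀ x ∈ H0, f x = 0) → IsNilpotent f) : H0 = ⊤ := by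
  obtain ⟨g, hg⟩ := LinearMap.exists_leftInverse_of_injective H0.subtype H0.ker_subtype
  set s := H0.subtype ∘ₗ g with hs
  have hsid (x : H) (hx : x ∈ H0) : s x = x := by
    have := LinearMap.congr_fun hg ⟨x, hx⟩
    simp only [LinearMap.comp_apply, Submodule.subtype_apply, LinearMap.id_apply] at this
    simp [hs, this]
  have hsmem (x : H) : s x ∈ H0 := (g x).2
  let e : WithConv (H →ₗ[k] k) := toConv (l.ofConv ∘ₗ
    (toConv LinearMap.id * toConv (antipode k ∘ₗ s) : WithConv (H →ₗ[k] H)).ofConv)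
  have he (x : H) (hx : x ∈ H0) : e x = counit (R := k) x * l 1 := by
    obtain ⟨u, hu⟩ := hsub x hx
    have h2 : (toConv LinearMap.id * toConv (antipode k ∘ₗ s) : WithConv (H →ₗ[k] H)) x =
        (toConv LinearMap.id * toConv (antipode k) : WithConv (H →ₗ[k] H)) x := by
      rw [LinearMap.convMul_apply, LinearMap.convMul_apply, ← hu]
      congr 1
      clear hu
      induction u with
      | zero => simp
      | add a b ha hb => simp only [map_add]; rw [ha, hb]
      | tmul a b => simp [hsid b b.2]
    rw [LinearMap.id_mul_antipode] at h2
    change l ((toConv LinearMap.id * toConv (antipode k ∘ₗ s) : WithConv (H →ₗ[k] H)) x) = _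
    rw [h2]
    simp [Algebra.algebraMap_eq_smul_one]
  have hje (j : WithConv (H →ₗ[k] k)) (hj : ∀ x ∈ H0, j x = 0) : j * e = 0 := by
    have h3 : j * e = toConv (l.ofConv ∘ₗ (toConv (contrL j.ofConv ∘ₗ comul) *
        toConv (antipode k ∘ₗ s)).ofConv) := by
      have h4 : (toConv (contrL j.ofConv ∘ₗ comul) : WithConv (H →ₗ[k] H)) =
          toConv (j.ofConv.smulRight 1) * toConv LinearMap.id := by
        ext x
        rw [(ℛ k x).convMul_apply, LinearMap.comp_apply, ← (ℛ k x).eq]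
        simp
      rw [h4, mul_assoc]
      ext x
      rw [(ℛ k x).convMul_apply, LinearMap.comp_apply, (ℛ k x).convMul_apply]
      simp [e]
    rw [h3]
    ext x
    rw [LinearMap.comp_apply, (ℛ k x).convMul_apply, map_sum]
    refine Finset.sum_eq_zero fun i _ => ?_
    generalize (ℛ k x).left i = y
    generalize (ℛ k x).right i = w
    have h5 := congrArg j.ofConv (LinearMap.congr_fun (int_antipode hl y) (s w))
    obtain ⟨u, hu⟩ := hsub (s w) (hsmem w)
    have h6 : j.ofConv ((contrL (l.ofConv ∘ₗ LinearMap.mulLeft k y ∘ₗ antipode k) ∘ₗ comul) (s w))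
        = 0 := by
      rw [LinearMap.comp_apply, ← hu]
      clear hu
      induction u with
      | zero => simp
      | add a b ha hb => simp only [map_add]; rw [ha, hb, add_zero]
      | tmul a b => simp [hj b b.2]
    rw [h6] at h5
    rw [← h5]
    simp only [LinearMap.comp_apply, LinearMap.mulLeft_apply]
    generalize (comul (R := k) y) = v
    induction v with
    | zero => simp
    | add a b ha hb => simp only [map_add, add_mul]; rw [← ha, ← hb]
    | tmul a b => simp [mul_comm]
  have hunit : IsUnit ((l 1)⁻¹ • e) := by
    have := (hnil ((l 1)⁻¹ • e - 1) fun x hx => ?_).isUnit_one_add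
    · simpa using this
    · have := he x hx
      simp only [ofConv_sub, ofConv_smul, LinearMap.sub_apply, LinearMap.smul_apply, this]
      simp
      field_simp
      simp
  rw [← Submodule.dualAnnihilator_eq_bot_iff, eq_bot_iff]
  intro f hf
  have h7 : toConv f * ((l 1)⁻¹ • e) = 0 := by
    rw [mul_smul_comm, hje (toConv f) ((Submodule.mem_dualAnnihilator f).mp hf), smul_zero]
  exact toConv_injective (hunit.mul_left_eq_zero.mp h7)

omit [FiniteDimensional k H] in
lemma mul_vanish_right {D : Submodule k H} (hD : HopfClass.IsSubcoalgWrt k comul D)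
    {f : WithConv (H →ₗ[k] k)} (hf : ∀ x ∈ D, f x = 0) (h : WithConv (H →ₗ[k] k)) :
    ∀ x ∈ D, (h * f) x = 0 := by
  intro x hx
  obtain ⟨u, hu⟩ := hD x hx
  rw [LinearMap.convMul_apply, ← hu]
  clear hu
  induction u with
  | zero => simp
  | add a b ha hb => simp only [map_add]; rw [ha, hb, add_zero]
  | tmul a b => simp [hf b b.2]

omit [FiniteDimensional k H] in
lemma mul_vanish_left {D : Submodule k H} (hD : HopfClass.IsSubcoalgWrt k comul D)
    {f : WithConv (H →ₗ[k] k)} (hf : ∀ x ∈ D, f x = 0) (h : WithConv (H →ₗ[k] k)) :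
    ∀ x ∈ D, (f * h) x = 0 := by
  intro x hx
  obtain ⟨u, hu⟩ := hD x hx
  rw [LinearMap.convMul_apply, ← hu]
  clear hu
  induction u with
  | zero => simp
  | add a b ha hb => simp only [map_add]; rw [ha, hb, add_zero]
  | tmul a b => simp [hf a a.2]

omit [FiniteDimensional k H] in
lemma isSubcoalgWrt_coradical :
    HopfClass.IsSubcoalgWrt k (comul : H →ₗ[k] H ⊗[k] H) (HopfClass.coradical k H) := by
  suffices HopfClass.coradical k H ≤ (LinearMap.range (TensorProduct.map
      (HopfClass.coradical k H).subtype (HopfClass.coradical k H).subtype)).comap comul from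
    fun x hx => this hx
  conv_lhs => rw [HopfClass.coradical]
  refine sSup_le fun C hC x hx => ?_
  have hle : C ≤ HopfClass.coradical k H := le_sSup hC
  obtain ⟨u, hu⟩ := hC.1 x hx
  refine ⟨TensorProduct.map (Submodule.inclusion hle) (Submodule.inclusion hle) u, ?_⟩
  rw [← LinearMap.comp_apply, ← TensorProduct.map_comp, Submodule.subtype_comp_inclusion]
  exact hu

lemma eq_of_dual_tmul {u v : H ⊗[k] H} (h : ∀ f g : H →ₗ[k] k,
    LinearMap.mul' k k (TensorProduct.map f g u) = LinearMap.mul' k k (TensorProduct.map f g v)) :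
    u = v := by
  have h1 (w : H ⊗[k] H) : w = ∑ i, (Module.finBasis k H i) ⊗ₜ[k]
      contrL ((Module.finBasis k H).coord i) w := by
    induction w with
    | zero => simp
    | add a b ha hb =>
      conv_lhs => rw [ha, hb]
      simp [TensorProduct.tmul_add, Finset.sum_add_distrib]
    | tmul a b =>
      simp only [contrL_tmul, TensorProduct.tmul_smul, TensorProduct.smul_tmul']
      rw [← TensorProduct.sum_tmul]
      simp [(Module.finBasis k H).sum_repr a]
  have h2 (f g : H →ₗ[k] k) (w : H ⊗[k] H) :
      LinearMap.mul' k k (TensorProduct.map f g w) = g (contrL f w) := by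
    induction w with
    | zero => simp
    | add a b ha hb => simp only [map_add, ha, hb]
    | tmul a b => simp
  rw [h1 u, h1 v]
  refine Finset.sum_congr rfl fun i _ => ?_
  congr 1
  refine eq_of_dual (k := k) fun g => ?_
  rw [← h2, ← h2, h]

lemma rep_vanish {d : ℕ} [NeZero d]
    (φ : WithConv (H →ₗ[k] k) →ₐ[k] Matrix (Fin d) (Fin d) k) (hφ : Function.Surjective φ)
    {f : WithConv (H →ₗ[k] k)} (hf : ∀ x ∈ HopfClass.coradical k H, f x = 0) : φ f = 0 := by
  have hc : ∃ c : Fin d → Fin d → H, ∀ f i j, φ f i j = f (c i j) := by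
    refine ⟨fun i j => (Module.evalEquiv k H).symm (Matrix.entryLinearMap k k i j ∘ₗ
      φ.toLinearMap ∘ₗ (WithConv.linearEquiv k (H →ₗ[k] k)).symm.toLinearMap), fun f i j => ?_⟩
    exact (Module.apply_evalEquiv_symm_apply k H f.ofConv (Matrix.entryLinearMap k k i j ∘ₗ
      φ.toLinearMap ∘ₗ (WithConv.linearEquiv k (H →ₗ[k] k)).symm.toLinearMap)).symm
  obtain ⟨c, hc⟩ := hc
  have hΔ (i j) : comul (R := k) (c i j) = ∑ l, c i l ⊗ₜ[k] c l j := by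
    refine eq_of_dual_tmul fun f g => ?_
    have := hc (toConv f * toConv g) i j
    rw [map_mul, Matrix.mul_apply] at this
    rw [LinearMap.convMul_apply] at this
    refine this.symm.trans ?_
    simp [hc]
  set D := Submodule.span k (Set.range fun p : Fin d × Fin d => c p.1 p.2) with hD
  have hcD (i j) : c i j ∈ D := Submodule.subset_span ⟨(i, j), rfl⟩
  have hDsub : HopfClass.IsSubcoalgWrt k (comul : H →ₗ[k] H ⊗[k] H) D := by
    suffices D ≤ (LinearMap.range (TensorProduct.map D.subtype D.subtype)).comap comul from
      fun x hx => this hx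
    rw [hD, Submodule.span_le]
    rintro _ ⟨p, rfl⟩
    simp only [SetLike.mem_coe, Submodule.mem_comap, hΔ]
    exact Submodule.sum_mem _ fun l _ => ⟨⟨c p.1 l, hcD _ _⟩ ⊗ₜ ⟨c l p.2, hcD _ _⟩, by simp⟩
  have hDne : D ≠ ⊥ := by
    intro h0
    have h1 := hcD 0 0
    rw [h0, Submodule.mem_bot] at h1
    have := hc 1 0 0
    rw [h1] at this
    simp at this
  have hDsimple : HopfClass.IsSimpleSubcoalgWrt k (comul : H →ₗ[k] H ⊗[k] H) D := by
    refine ⟨hDsub, hDne, fun D' hD' hlt => ?_⟩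
    obtain ⟨f, hfD, p, q, hpq⟩ : ∃ f : WithConv (H →ₗ[k] k), (∀ x ∈ D', f x = 0) ∧
        ∃ p q, φ f p q ≠ 0 := by
      by_contra! hcon
      refine hlt.not_ge ?_
      rw [hD, Submodule.span_le]
      rintro _ ⟨p, rfl⟩
      by_contra hmem
      obtain ⟨f, hf1, hf2⟩ := Submodule.exists_le_ker_of_notMem (K := k) hmem
      refine hf1 ?_
      have := hcon (toConv f) (fun x hx => hf2 hx) p.1 p.2
      rwa [hc] at this
    choose ψ hψ using hφ
    set f' := ∑ r, ψ (Matrix.single r p 1) * f * ψ (Matrix.single q r 1) with hf'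
    have h1 : φ f' = φ f p q • 1 := by
      simp only [hf', map_sum, map_mul, hψ, Matrix.single_mul_mul_single, one_mul, mul_one]
      rw [Matrix.sum_single_eq_diagonal, ← Matrix.smul_one_eq_diagonal]
    have h2 (h : WithConv (H →ₗ[k] k)) : ∀ x ∈ D', (h * f') x = 0 := by
      refine mul_vanish_right hD' (fun x hx => ?_) h
      rw [hf', ofConv_sum, LinearMap.sum_apply]
      exact Finset.sum_eq_zero fun r _ =>
        mul_vanish_left hD' (mul_vanish_right hD' hfD _) _ x hx
    rw [eq_bot_iff]
    intro x hx
    rw [Submodule.mem_bot]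
    refine eq_of_dual (k := k) fun h => ?_
    have h3 : ∀ y ∈ D, (toConv h * f') y = φ f p q • h y := by
      intro y hy
      induction hy using Submodule.span_induction with
      | mem y hy =>
        obtain ⟨r, rfl⟩ := hy
        rw [← hc, map_mul, h1, mul_smul_comm, mul_one, Matrix.smul_apply, hc (toConv h)]
      | zero => simp
      | add a b _ _ ha hb => rw [map_add, ha, hb, map_add, smul_add]
      | smul a b _ hb => rw [map_smul, hb, map_smul, smul_comm]
    have h4 := h3 x (hlt.le hx)
    rw [h2 _ x hx] at h4
    rw [map_zero]
    exact (smul_eq_zero.mp h4.symm).resolve_left hpq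
  ext i j
  rw [hc]
  exact hf _ ((le_sSup hDsimple : D ≤ HopfClass.coradical k H) (hcD i j))

instance : Module.Finite k (WithConv (H →ₗ[k] k)) :=
  Module.Finite.equiv (WithConv.linearEquiv k (H →ₗ[k] k)).symm

instance : IsArtinianRing (WithConv (H →ₗ[k] k)) := IsArtinianRing.of_finite k _

lemma mem_jacobson_of_vanish [IsAlgClosed k]
    {f : WithConv (H →ₗ[k] k)} (hf : ∀ x ∈ HopfClass.coradical k H, f x = 0) :
    f ∈ Ring.jacobson (WithConv (H →ₗ[k] k)) := by
  have : IsSemisimpleRing (WithConv (H →ₗ[k] k) ⧸ Ring.jacobson (WithConv (H →ₗ[k] k))) :=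
    IsSemiprimaryRing.isSemisimpleRing
  obtain ⟨n, d, hd, ⟨e⟩⟩ := IsSemisimpleRing.exists_algEquiv_pi_matrix_of_isAlgClosed k
    (WithConv (H →ₗ[k] k) ⧸ Ring.jacobson (WithConv (H →ₗ[k] k)))
  rw [← Ideal.Quotient.eq_zero_iff_mem]
  refine e.injective ?_
  rw [map_zero]
  ext1 i
  have := hd i
  refine rep_vanish ((Pi.evalAlgHom k _ i).comp (e.toAlgHom.comp
    (Ideal.Quotient.mkₐ k (Ring.jacobson (WithConv (H →ₗ[k] k)))))) ?_ hf
  exact (Function.surjective_eval i).comp (e.surjective.comp Ideal.Quotient.mk_surjective)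

omit [FiniteDimensional k H] in
/-- The character of the convolution algebra given by evaluation at a group-like element. -/
noncomputable def evalGroupLike (g : GroupLike k H) : WithConv (H →ₗ[k] k) →ₐ[k] k :=
  AlgHom.ofLinearMap
    { toFun := fun a => a (g : H), map_add' := fun _ _ => rfl, map_smul' := fun _ _ => rfl }
    (by
      change (1 : WithConv (H →ₗ[k] k)) (g : H) = 1
      rw [LinearMap.convOne_apply]
      simp)
    (fun a b => by
      change (a * b) (g : H) = a (g : H) * b (g : H)
      rw [LinearMap.convMul_apply]
      simp)

omit [FiniteDimensional k H] in
lemma evalGroupLike_apply (g : GroupLike k H) (a : WithConv (H →ₗ[k] k)) :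
    evalGroupLike g a = a (g : H) := rfl

omit [FiniteDimensional k H] in
/-- Right translation of functionals by a group-like element. -/
noncomputable def rtrans (s : GroupLike k H) (a : WithConv (H →ₗ[k] k)) : WithConv (H →ₗ[k] k) :=
  toConv (a.ofConv ∘ₗ LinearMap.mulRight k (s : H))

omit [FiniteDimensional k H] in
lemma rtrans_apply (s : GroupLike k H) (a : WithConv (H →ₗ[k] k)) (x : H) :
    rtrans s a x = a (x * s) := rfl

omit [FiniteDimensional k H] in
lemma rtrans_mul (s : GroupLike k H) (a b : WithConv (H →ₗ[k] k)) :
    rtrans s (a * b) = rtrans s a * rtrans s b := by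
  ext x
  change (a * b) (x * s) = (rtrans s a * rtrans s b) x
  rw [LinearMap.convMul_apply, LinearMap.convMul_apply, Bialgebra.comul_mul,
    s.isGroupLikeElem_val.comul_eq_tmul_self]
  generalize comul (R := k) x = u
  induction u with
  | zero => simp
  | add u v hu hv => simp only [add_mul, map_add, hu, hv]
  | tmul u v => simp [rtrans_apply]

omit [FiniteDimensional k H] in
lemma rtrans_rtrans_inv (s : GroupLike k H) (a : WithConv (H →ₗ[k] k)) :
    rtrans s (rtrans s⁻¹ a) = a := by
  ext x
  change a (x * s * (s⁻¹ : GroupLike k H)) = a x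
  rw [mul_assoc, ← GroupLike.val_mul, mul_inv_cancel, GroupLike.val_one, mul_one]

omit [FiniteDimensional k H] in
lemma rtrans_smul (s : GroupLike k H) (c : k) (a : WithConv (H →ₗ[k] k)) :
    rtrans s (c • a) = c • rtrans s a := rfl

omit [FiniteDimensional k H] in
lemma isInt_rtrans {g : GroupLike k H} {l : WithConv (H →ₗ[k] k)} (hl : IsInt (g : H) l)
    (s : GroupLike k H) : IsInt ((g * s⁻¹ : GroupLike k H) : H) (rtrans s l) := by
  intro b
  rw [← rtrans_rtrans_inv s b, ← rtrans_mul, hl, rtrans_smul, rtrans_rtrans_inv]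
  rfl

lemma isInt_unique {g : GroupLike k H} {l m : WithConv (H →ₗ[k] k)} (hl : IsInt (g : H) l)
    (hl0 : l ≠ 0) (hm : IsInt (g : H) m) : ∃ c : k, m = c • l := by
  have h1 {l : WithConv (H →ₗ[k] k)} (hl : IsInt (g : H) l) : IsInt 1 (rtrans g l) := by
    have := isInt_rtrans hl g
    rwa [mul_inv_cancel, GroupLike.val_one] at this
  have h2 (l : WithConv (H →ₗ[k] k)) : rtrans g⁻¹ (rtrans g l) = l := by
    conv_lhs => rw [← inv_inv g]
    simpa using rtrans_rtrans_inv g⁻¹ l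
  obtain ⟨c, hc⟩ := int_unique (h1 hl) (fun h0 => hl0 (by rw [← h2 l, h0]; rfl)) (h1 hm)
  exact ⟨c, by rw [← h2 m, hc, rtrans_smul, h2]⟩

/-- The element of `H` representing a functional on the convolution algebra. -/
noncomputable def repr (θ : WithConv (H →ₗ[k] k) →ₗ[k] k) : H :=
  (Module.evalEquiv k H).symm (θ ∘ₗ (WithConv.linearEquiv k (H →ₗ[k] k)).symm.toLinearMap)

lemma apply_repr (θ : WithConv (H →ₗ[k] k) →ₗ[k] k) (a : WithConv (H →ₗ[k] k)) :
    a (repr θ) = θ a :=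
  Module.apply_evalEquiv_symm_apply k H a.ofConv
    (θ ∘ₗ (WithConv.linearEquiv k (H →ₗ[k] k)).symm.toLinearMap)

lemma exists_groupLike (φ : WithConv (H →ₗ[k] k) →ₐ[k] k) : ∃ g, φ = evalGroupLike g := by
  have hg : IsGroupLikeElem k (repr φ.toLinearMap) := by
    constructor
    · have := apply_repr φ.toLinearMap (1 : WithConv (H →ₗ[k] k))
      rw [LinearMap.convOne_apply] at this
      simpa using this
    · refine eq_of_dual_tmul fun a b => ?_
      have := apply_repr φ.toLinearMap (toConv a * toConv b)
      rw [LinearMap.convMul_apply] at this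
      refine this.trans ?_
      simp only [AlgHom.toLinearMap_apply, map_mul, TensorProduct.map_tmul, LinearMap.mul'_apply]
      congr 1
      · exact (apply_repr φ.toLinearMap (toConv a)).symm
      · exact (apply_repr φ.toLinearMap (toConv b)).symm
  exact ⟨⟨_, hg⟩, AlgHom.ext fun a => (apply_repr φ.toLinearMap a).symm⟩

lemma exists_right_character {g : GroupLike k H} {l : WithConv (H →ₗ[k] k)}
    (hl : IsInt (g : H) l) : ∃ h : GroupLike k H, ∀ a, l * a = evalGroupLike h a • l := by
  by_cases hl0 : l = 0
  · exact ⟨1, by simp [hl0]⟩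
  have h1 (a) : ∃ c : k, l * a = c • l :=
    isInt_unique hl hl0 fun b => by rw [← mul_assoc, hl, smul_mul_assoc]
  choose c hc using h1
  have hinj {x y : k} (h : x • l = y • l) : x = y := smul_left_injective k hl0 h
  let φ : WithConv (H →ₗ[k] k) →ₐ[k] k := AlgHom.ofLinearMap
    { toFun := c
      map_add' := fun a b => hinj (by rw [← hc, mul_add, hc, hc, add_smul])
      map_smul' := fun r a => hinj (by
        rw [← hc, mul_smul_comm, hc, smul_smul, RingHom.id_apply, smul_eq_mul]) }
    (hinj (by
      change c 1 • l = _
      rw [← hc, mul_one, one_smul]))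
    (fun a b => hinj (by
      change c (a * b) • l = (c a * c b) • l
      rw [← hc, ← mul_assoc, hc, smul_mul_assoc, hc, smul_smul]))
  obtain ⟨h, hh⟩ := exists_groupLike φ
  exact ⟨h, fun a => by rw [← hh, hc]; rfl⟩

variable (k H) in
lemma exists_int_translates : ∃ (l : WithConv (H →ₗ[k] k)) (α : GroupLike k H), IsInt 1 l ∧
    ∀ s : GroupLike k H, rtrans s l ≠ 0 ∧
      (∀ a, a * rtrans s l = evalGroupLike s⁻¹ a • rtrans s l) ∧
      ∀ a, rtrans s l * a = evalGroupLike (α * s⁻¹) a • rtrans s l := by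
  obtain ⟨l, hl0, hl⟩ := exists_int (k := k) (H := H)
  have hl' : IsInt ((1 : GroupLike k H) : H) l := hl
  obtain ⟨α, hα⟩ := exists_right_character hl'
  refine ⟨l, α, hl, fun s => ⟨fun h0 => hl0 ?_, fun a => ?_, fun a => ?_⟩⟩
  · have h2 := rtrans_rtrans_inv s⁻¹ l
    rw [inv_inv, h0] at h2
    exact h2.symm
  · have := isInt_rtrans hl' s a
    rwa [one_mul] at this
  · conv_lhs => rw [← rtrans_rtrans_inv s a, ← rtrans_mul, hα, rtrans_smul]
    rfl

section Comatrix

variable {ι : Type*} {m : ι → ℕ} {c : Π b, Fin (m b) → Fin (m b) → H}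

omit [FiniteDimensional k H] in
/-- The representation of the convolution algebra on matrices given by a family of
multiplicative matrices. -/
noncomputable def comatrixRep (k : Type*) [Field k] {H : Type*} [Ring H] [HopfAlgebra k H]
    {ι : Type*} {m : ι → ℕ} (c : Π b, Fin (m b) → Fin (m b) → H)
    (hΔ : ∀ b i j, comul (R := k) (c b i j) = ∑ l, c b i l ⊗ₜ[k] c b l j)
    (hε : ∀ b i j, counit (R := k) (c b i j) = if i = j then 1 else 0) :
    WithConv (H →ₗ[k] k) →ₐ[k] Π b, Matrix (Fin (m b)) (Fin (m b)) k :=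
  AlgHom.ofLinearMap
    { toFun := fun a b => Matrix.of fun i j => a (c b i j)
      map_add' := fun _ _ => rfl
      map_smul' := fun _ _ => rfl }
    (by
      ext b i j
      change (1 : WithConv (H →ₗ[k] k)) (c b i j) = (1 : Matrix _ _ k) i j
      rw [LinearMap.convOne_apply, hε, Matrix.one_apply]
      simp)
    (fun f g => by
      ext b i j
      change (f * g) (c b i j) = ∑ l, f (c b i l) * g (c b l j)
      rw [LinearMap.convMul_apply, hΔ]
      simp)

variable (hΔ : ∀ b i j, comul (R := k) (c b i j) = ∑ l, c b i l ⊗ₜ[k] c b l j)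
  (hε : ∀ b i j, counit (R := k) (c b i j) = if i = j then 1 else 0)

omit [FiniteDimensional k H] in
lemma comatrixRep_apply (a : WithConv (H →ₗ[k] k)) (b i j) :
    comatrixRep k c hΔ hε a b i j = a (c b i j) := rfl

omit [FiniteDimensional k H] in
lemma comatrixRep_surjective
    (hli : LinearIndependent k fun p : Σ b, Fin (m b) × Fin (m b) => c p.1 p.2.1 p.2.2) :
    Function.Surjective (comatrixRep k c hΔ hε) := by
  intro M
  obtain ⟨f, hf⟩ := LinearMap.exists_extend
    ((Module.Basis.span hli).constr k fun p => M p.1 p.2.1 p.2.2)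
  refine ⟨toConv f, ?_⟩
  ext b i j
  rw [comatrixRep_apply]
  have h1 := (Module.Basis.span hli).constr_basis k (fun p => M p.1 p.2.1 p.2.2) ⟨b, i, j⟩
  rw [← hf] at h1
  simpa [Module.Basis.span_apply] using h1

omit [FiniteDimensional k H] in
lemma vanish_of_comatrixRep_eq_zero {a : WithConv (H →ₗ[k] k)}
    (ha : comatrixRep k c hΔ hε a = 0) :
    ∀ x ∈ Submodule.span k (Set.range fun p : Σ b, Fin (m b) × Fin (m b) => c p.1 p.2.1 p.2.2),
      a x = 0 := by
  intro x hx
  have : Submodule.span k (Set.range fun p : Σ b, Fin (m b) × Fin (m b) => c p.1 p.2.1 p.2.2) ≤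
      LinearMap.ker a.ofConv := by
    rw [Submodule.span_le]
    rintro _ ⟨p, rfl⟩
    exact congrFun (congrFun (congrFun ha p.1) p.2.1) p.2.2
  exact this hx

lemma finrank_span_add_finrank_ker [Fintype ι]
    (hli : LinearIndependent k fun p : Σ b, Fin (m b) × Fin (m b) => c p.1 p.2.1 p.2.2) :
    Module.finrank k (Submodule.span k
      (Set.range fun p : Σ b, Fin (m b) × Fin (m b) => c p.1 p.2.1 p.2.2)) +
      Module.finrank k (LinearMap.ker (comatrixRep k c hΔ hε).toLinearMap) =
    Module.finrank k H := by
  rw [finrank_span_eq_card hli]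
  have h1 := (comatrixRep k c hΔ hε).toLinearMap.finrank_range_add_finrank_ker
  rw [LinearMap.range_eq_top.2 (comatrixRep_surjective hΔ hε hli), finrank_top,
    Module.finrank_pi_fintype, (WithConv.linearEquiv k (H →ₗ[k] k)).finrank_eq] at h1
  have h2 : Module.finrank k (H →ₗ[k] k) = Module.finrank k H := Subspace.dual_finrank_eq
  rw [← h2, ← h1]
  simp [Module.finrank_matrix]

end Comatrix

omit [FiniteDimensional k H] in
lemma pow_eq_bot_of_mem_jacobson {A : Type*} [Ring A] [Algebra k A] [IsArtinianRing A]
    {J : Submodule k A} (hJ : ∀ f ∈ J, f ∈ Ring.jacobson A) : ∃ m, J ^ m = ⊥ := by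
  obtain ⟨m, hm⟩ := IsSemiprimaryRing.isNilpotent (R := A)
  refine ⟨m, ?_⟩
  have key (r : ℕ) : J ^ r ≤ ((Ring.jacobson A) ^ r).restrictScalars k := by
    induction r with
    | zero => intro x _; rw [Submodule.pow_zero, Ideal.one_eq_top]; trivial
    | succ r ih =>
      rw [pow_succ, Submodule.mul_le]
      intro x hx y hy
      rw [Submodule.restrictScalars_mem, Submodule.pow_succ]
      exact Ideal.mul_mem_mul (ih hx) (hJ y hy)
  rw [eq_bot_iff]
  intro x hx
  have := key m hx
  rw [Submodule.restrictScalars_mem, hm] at this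
  exact this

omit [FiniteDimensional k H] in
lemma isNilpotent_of_mem_jacobson {A : Type*} [Ring A] [IsArtinianRing A]
    {x : A} (hx : x ∈ Ring.jacobson A) : IsNilpotent x := by
  obtain ⟨m, hm⟩ := IsSemiprimaryRing.isNilpotent (R := A)
  refine ⟨m, ?_⟩
  have key (r : ℕ) : x ^ r ∈ (Ring.jacobson A) ^ r := by
    induction r with
    | zero => rw [pow_zero, Submodule.pow_zero, Ideal.one_eq_top]; trivial
    | succ r ih =>
      rw [pow_succ, Submodule.pow_succ]
      exact Ideal.mul_mem_mul ih hx
  have := key m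
  rw [hm] at this
  exact this

lemma apply_one_eq_zero_of_isInt [IsAlgClosed k] (hncs : ¬ HopfClass.IsCosemisimple k H)
    {l : WithConv (H →ₗ[k] k)} (hl : IsInt 1 l) : l 1 = 0 := by
  by_contra h1
  exact hncs (eq_top_of_int_one_ne_zero hl h1 _ isSubcoalgWrt_coradical
    fun f hf => isNilpotent_of_mem_jacobson (mem_jacobson_of_vanish hf))

omit [FiniteDimensional k H] in
lemma isGrouplikeWrt_iff {g : H} :
    HopfClass.IsGrouplikeWrt k (comul : H →ₗ[k] H ⊗[k] H) g ↔ IsGroupLikeElem k g := by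
  refine ⟨fun ⟨h0, h⟩ => ⟨?_, h⟩, fun h => ⟨h.ne_zero, h.comul_eq_tmul_self⟩⟩
  have h1 := rTensor_counit_comul (R := k) g
  rw [h, LinearMap.rTensor_tmul] at h1
  have h2 := congrArg (TensorProduct.lid k H) h1
  simp only [TensorProduct.lid_tmul, one_smul] at h2
  exact smul_left_injective k h0 (h2.trans (one_smul k g).symm)

lemma eq_zero_of_skew_derivation
    (hnsp : HopfClass.HasNoNontrivialSkewPrimitivesWrt k (comul : H →ₗ[k] H ⊗[k] H))
    {g h : GroupLike k H} {θ : WithConv (H →ₗ[k] k) →ₗ[k] k}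
    (hθ : ∀ a b, θ (a * b) = evalGroupLike g a * θ b + θ a * evalGroupLike h b)
    {x : WithConv (H →ₗ[k] k)} (hg : x (g : H) = 0) (hh : x (h : H) = 0) : θ x = 0 := by
  obtain ⟨c, hc⟩ := hnsp g h (repr θ) (isGrouplikeWrt_iff.2 g.isGroupLikeElem_val)
    (isGrouplikeWrt_iff.2 h.isGroupLikeElem_val) (eq_of_dual_tmul fun a b => by
      have := apply_repr θ (toConv a * toConv b)
      rw [LinearMap.convMul_apply] at this
      refine this.trans ?_
      rw [hθ, ← apply_repr, ← apply_repr]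
      simp [evalGroupLike_apply])
  rw [← apply_repr, hc, map_smul, map_sub, hg, hh, sub_zero, smul_zero]

section Main

variable {Q : Type*} [Fintype Q] {d : Q → ℕ}
  {c : Π b : GroupLike k H ⊕ Q, Fin (Sum.elim (fun _ => 1) d b) →
    Fin (Sum.elim (fun _ => 1) d b) → H}

lemma le_finrank_of_comatrix [IsAlgClosed k] [Fintype (GroupLike k H)] {n : ℕ}
    (hncs : ¬ HopfClass.IsCosemisimple k H)
    (hnsp : HopfClass.HasNoNontrivialSkewPrimitivesWrt k (comul : H →ₗ[k] H ⊗[k] H))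
    (hn : ∀ q, n ≤ d q)
    (hΔ : ∀ b i j, comul (R := k) (c b i j) = ∑ l, c b i l ⊗ₜ[k] c b l j)
    (hε : ∀ b i j, counit (R := k) (c b i j) = if i = j then 1 else 0)
    (hcg : ∀ g : GroupLike k H, c (.inl g) = fun _ _ => (g : H))
    (hli : LinearIndependent k fun p : Σ b, Fin (Sum.elim (fun _ => 1) d b) ×
      Fin (Sum.elim (fun _ => 1) d b) => c p.1 p.2.1 p.2.2)
    (hspan : Submodule.span k (Set.range fun p : Σ b, Fin (Sum.elim (fun _ => 1) d b) ×
      Fin (Sum.elim (fun _ => 1) d b) => c p.1 p.2.1 p.2.2) = HopfClass.coradical k H) :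
    Module.finrank k (HopfClass.coradical k H) +
      ((2 * n + 1) * Fintype.card (GroupLike k H) + n ^ 2) ≤ Module.finrank k H := by
  classical
  have hπ := comatrixRep_surjective hΔ hε hli
  have hrank := finrank_span_add_finrank_ker hΔ hε hli
  have hvan (a) (ha : comatrixRep k c hΔ hε a = 0) := vanish_of_comatrixRep_eq_zero hΔ hε ha
  rw [hspan] at hrank hvan
  rw [← hrank]
  refine Nat.add_le_add_left ?_ _
  set π := comatrixRep k c hΔ hε with hπdef
  have hχ (g : GroupLike k H) (a) : π a (.inl g) = Matrix.of fun _ _ => evalGroupLike g a := by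
    ext i j
    rw [hπdef, comatrixRep_apply, hcg]
    rfl
  have hχ0 (g : GroupLike k H) {a} (ha : π a = 0) : a (g : H) = 0 := by
    have := congrFun (congrFun (hχ g a) (0 : Fin 1)) (0 : Fin 1)
    rw [ha] at this
    exact this.symm
  obtain ⟨l, α, hl, hls⟩ := exists_int_translates k H
  have hπl (s : GroupLike k H) : π (rtrans s l) = 0 := by
    obtain ⟨-, hs, -⟩ := hls s
    ext1 b
    by_cases hb : b = .inl s⁻¹
    · subst hb
      rw [hχ, evalGroupLike_apply, rtrans_apply, ← GroupLike.val_mul, inv_mul_cancel,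
        GroupLike.val_one, apply_one_eq_zero_of_isInt hncs hl]
      rfl
    · obtain ⟨a, ha⟩ := hπ (Pi.single b 1)
      have h1 := congrFun (congrArg π (hs a)) b
      have h2 := hχ s⁻¹ a
      rw [ha, Pi.single_eq_of_ne (Ne.symm hb)] at h2
      have h3 : evalGroupLike s⁻¹ a = 0 := (congrFun (congrFun h2 (0 : Fin 1)) (0 : Fin 1)).symm
      rw [map_mul, Pi.mul_apply, ha, Pi.single_eq_same, one_mul, h3, zero_smul, map_zero] at h1
      exact h1
  refine le_finrank_ker (χ := evalGroupLike) hn hπ (fun x hx => isNilpotent_of_mem_jacobson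
    (mem_jacobson_of_vanish (hvan x hx)))
    (pow_eq_bot_of_mem_jacobson fun f hf => mem_jacobson_of_vanish (hvan f hf)) hχ
    (fun g h θ hθ x hx => eq_zero_of_skew_derivation hnsp hθ (hχ0 g hx) (hχ0 h hx))
    (fun g => ⟨α * g, rtrans g⁻¹ l, (hls _).1, hπl _, ?_, ?_⟩)
    (fun h => ⟨α⁻¹ * h, rtrans (h⁻¹ * α) l, (hls _).1, hπl _, ?_, ?_⟩)
    (fun g x hx => exists_right_character (g := g) (l := x) hx)
  · simpa using (hls g⁻¹).2.1
  · simpa using (hls g⁻¹).2.2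
  · simpa using (hls (h⁻¹ * α)).2.1
  · simpa using (hls (h⁻¹ * α)).2.2

end Main

section Assembly

variable {Q : Type*} {d : Q → ℕ} {D : Q → Submodule k H}
  {e : Π q, Fin (d q) → Fin (d q) → H}

omit [FiniteDimensional k H] in
lemma range_groupLike_val :
    Set.range (GroupLike.val : GroupLike k H → H) = HopfClass.grouplikes k H := by
  ext x
  exact ⟨fun ⟨g, hg⟩ => hg ▸ isGrouplikeWrt_iff.2 g.isGroupLikeElem_val,
    fun hx => ⟨⟨x, isGrouplikeWrt_iff.1 hx⟩, rfl⟩⟩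

/-- Group-like elements, viewed as multiplicative matrices of size one, together with
further multiplicative matrices. -/
def comatrixFamily (k : Type*) [Field k] {H : Type*} [Ring H] [HopfAlgebra k H] {Q : Type*}
    {d : Q → ℕ} (e : Π q, Fin (d q) → Fin (d q) → H) :
    Π b : GroupLike k H ⊕ Q, Fin (Sum.elim (fun _ => 1) d b) →
      Fin (Sum.elim (fun _ => 1) d b) → H
  | .inl g => fun _ _ => (g : H)
  | .inr q => e q

omit [FiniteDimensional k H] in
lemma exists_bijective_comatrixFamily (e : Π q, Fin (d q) → Fin (d q) → H) :
    ∃ φ : (Σ b : GroupLike k H ⊕ Q, Fin (Sum.elim (fun _ => 1) d b) ×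
      Fin (Sum.elim (fun _ => 1) d b)) → GroupLike k H ⊕ Σ q, Fin (d q) × Fin (d q),
      Function.Bijective φ ∧ (fun p => comatrixFamily k e p.1 p.2.1 p.2.2) =
        Sum.elim GroupLike.val (fun p => e p.1 p.2.1 p.2.2) ∘ φ := by
  refine ⟨fun | ⟨.inl g, _⟩ => .inl g | ⟨.inr q, p⟩ => .inr ⟨q, p⟩, ⟨?_, ?_⟩, ?_⟩
  · rintro ⟨g | q, i, j⟩ ⟨g' | q', i', j'⟩ h
    · obtain rfl := Sum.inl_injective h
      obtain rfl : i = i' := Subsingleton.elim (α := Fin 1) _ _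
      obtain rfl : j = j' := Subsingleton.elim (α := Fin 1) _ _
      rfl
    · cases h
    · cases h
    · cases h
      rfl
  · rintro (g | ⟨q, p⟩)
    · exact ⟨⟨.inl g, (0 : Fin 1), (0 : Fin 1)⟩, rfl⟩
    · exact ⟨⟨.inr q, p⟩, rfl⟩
  · ext ⟨g | q, i, j⟩ <;> rfl

omit [FiniteDimensional k H] in
lemma linearIndependent_comatrixFamily
    (hli : ∀ q, LinearIndependent k fun p : Fin (d q) × Fin (d q) => e q p.1 p.2)
    (hD : ∀ q, D q = Submodule.span k (Set.range fun p : Fin (d q) × Fin (d q) => e q p.1 p.2))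
    (hindep : iSupIndep fun o : Option Q =>
      o.elim (Submodule.span k (HopfClass.grouplikes k H)) D) :
    LinearIndependent k fun p : Σ b, Fin (Sum.elim (fun _ => 1) d b) ×
      Fin (Sum.elim (fun _ => 1) d b) => comatrixFamily k e p.1 p.2.1 p.2.2 := by
  obtain ⟨φ, hφ, hcomp⟩ := exists_bijective_comatrixFamily (k := k) e
  rw [hcomp]
  refine LinearIndependent.comp ?_ φ hφ.injective
  refine linearIndep_groupLikeVal.sum_type
    (linearIndependent_iUnion_finite hli fun q s _ hq => ?_) ?_
  · simp only [← hD]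
    refine (hindep (some q)).mono_right (iSup₂_le fun r hr => ?_)
    exact le_iSup₂_of_le (some r) (fun h => hq (Option.some_injective _ h ▸ hr)) le_rfl
  · rw [range_groupLike_val]
    refine (hindep none).mono_right (Submodule.span_le.2 ?_)
    rintro _ ⟨⟨q, p⟩, rfl⟩
    have h1 : e q p.1 p.2 ∈ D q := by
      rw [hD]
      exact Submodule.subset_span ⟨p, rfl⟩
    exact (le_iSup₂_of_le (some q) (by simp) le_rfl : D q ≤ _) h1

omit [FiniteDimensional k H] in
lemma span_comatrixFamily
    (hD : ∀ q, D q = Submodule.span k (Set.range fun p : Fin (d q) × Fin (d q) => e q p.1 p.2)) :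
    Submodule.span k (Set.range fun p : Σ b, Fin (Sum.elim (fun _ => 1) d b) ×
      Fin (Sum.elim (fun _ => 1) d b) => comatrixFamily k e p.1 p.2.1 p.2.2) =
    Submodule.span k (HopfClass.grouplikes k H) ⊔ ⨆ q, D q := by
  obtain ⟨φ, hφ, hcomp⟩ := exists_bijective_comatrixFamily (k := k) e
  rw [hcomp, hφ.surjective.range_comp, Set.Sum.elim_range, Submodule.span_union,
    range_groupLike_val, Set.range_sigma_eq_iUnion_range, Submodule.span_iUnion]
  simp only [hD]

end Assembly

end ConvAux

open HopfClass in
/-- If `H` is a non-cosemisimple Hopf algebra with no nontrivial skew-primitive elements whose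
coradical decomposes (as a coalgebra) as `kG ⊕ M*(n,k) ⊕ M*(n₁,k) ⊕ ⋯ ⊕ M*(n_t,k)` with
`G = G(H)`, `t ≥ 0` and `2 ≤ n ≤ n₁ ≤ ⋯ ≤ n_t`, then
`dim H ≥ dim H₀ + (2n+1)|G| + n²`. -/
theorem finrank_ge_of_no_nontrivial_skewPrimitives
    (k : Type*) [Field k] [IsAlgClosed k] [CharZero k]
    (H : Type*) [Ring H] [HopfAlgebra k H] [FiniteDimensional k H]
    (hncs : ¬ IsCosemisimple k H)
    (hnsp : HasNoNontrivialSkewPrimitivesWrt k (comulL k H))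
    (t n : ℕ) (ns : Fin t → ℕ)
    (hn2 : 2 ≤ n) (hmono : Monotone ns) (hnle : ∀ i, n ≤ ns i)
    (C : Submodule k H) (Cs : Fin t → Submodule k H)
    (hC : IsMatrixSubcoalg k H n C)
    (hCs : ∀ i, IsMatrixSubcoalg k H (ns i) (Cs i))
    (hindep : iSupIndep (fun i : Option (Option (Fin t)) =>
      i.elim (Submodule.span k (grouplikes k H)) (fun o => o.elim C (fun j => Cs j))))
    (hsup : coradical k H = Submodule.span k (grouplikes k H) ⊔ C ⊔ ⨆ i, Cs i) :
    Module.finrank k ↥(coradical k H) + (2 * n + 1) * (grouplikes k H).ncard + n ^ 2 ≤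
      Module.finrank k H := by
  have : Finite (GroupLike k H) := (linearIndep_groupLikeVal (R := k) (A := H)).finite
  have := Fintype.ofFinite (GroupLike k H)
  let d (q : Option (Fin t)) : ℕ := q.elim n ns
  let D (q : Option (Fin t)) : Submodule k H := q.elim C Cs
  have hD (q) : IsMatrixSubcoalg k H (d q) (D q) := by
    cases q with
    | none => exact hC
    | some i => exact hCs i
  choose e hli hspan hΔ hε using hD
  have hcard : (grouplikes k H).ncard = Fintype.card (GroupLike k H) := by
    rw [← ConvAux.range_groupLike_val, Set.ncard_range_of_injective GroupLike.val_injective,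
      Nat.card_eq_fintype_card]
  rw [hcard, add_assoc]
  have hcorad : coradical k H = Submodule.span k (grouplikes k H) ⊔ ⨆ q, D q := by
    rw [hsup, sup_assoc, iSup_option]
    rfl
  refine ConvAux.le_finrank_of_comatrix (c := ConvAux.comatrixFamily k e) hncs hnsp ?_ ?_ ?_
    (fun _ => rfl) (ConvAux.linearIndependent_comatrixFamily hli hspan hindep)
    ((ConvAux.span_comatrixFamily hspan).trans hcorad.symm)
  · rintro (_ | i)
    · exact le_rfl
    · exact hnle i
  · rintro (g | q) i j
    · exact g.isGroupLikeElem_val.comul_eq_tmul_self.trans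
        (Fin.sum_univ_one fun _ : Fin 1 => (g : H) ⊗ₜ[k] (g : H)).symm
    · exact hΔ q i j
  · rintro (g | q) i j
    · exact g.isGroupLikeElem_val.counit_eq_one.trans
        (if_pos (Subsingleton.elim (α := Fin 1) i j)).symm
    · exact hε q i j
end

section
/- Let p be an odd prime and L a Hopf algebra of dimension p³ containing a sub-Hopf algebra T isomorphic to the Taft Hopf algebra T_q of dimension p². Suppose there exist a grouplike element g ∈ G(L) and an element y ∈ L with y ∉ T such that Δ(y) = g⊗y + y⊗1 + y′ for some y′ ∈ T⊗T. Then L is pointed. -/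
open TensorProduct

namespace HopfClass

section Contraction

variable {k L : Type*} [Field k] [Ring L] [Algebra k L]

/-- The image of `X ⊗ Y` in `L ⊗ L`. -/
def tensorSub (X Y : Submodule k L) : Submodule k (L ⊗[k] L) :=
  Submodule.map₂ (TensorProduct.mk k L L) X Y

lemma tmul_mem_tensorSub {X Y : Submodule k L} {a b : L} (ha : a ∈ X) (hb : b ∈ Y) :
    a ⊗ₜ[k] b ∈ tensorSub X Y :=
  Submodule.apply_mem_map₂ _ ha hb

lemma tensorSub_mono {X X' Y Y' : Submodule k L} (hX : X ≤ X') (hY : Y ≤ Y') :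
    tensorSub X Y ≤ tensorSub X' Y' :=
  Submodule.map₂_le_map₂ hX hY

lemma range_map_subtype (X Y : Submodule k L) :
    LinearMap.range (TensorProduct.map X.subtype Y.subtype) = tensorSub X Y :=
  TensorProduct.range_mapIncl X Y

lemma tensorSub_mul_le (X X' Y Y' : Submodule k L) :
    tensorSub X Y * tensorSub X' Y' ≤ tensorSub (X * X') (Y * Y') := by
  rw [tensorSub, tensorSub, Submodule.map₂_eq_span_image2, Submodule.map₂_eq_span_image2,
    Submodule.span_mul_span, Submodule.span_le]
  rintro _ ⟨_, ⟨a, ha, b, hb, rfl⟩, _, ⟨c, hc, d, hd, rfl⟩, rfl⟩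
  simp only [TensorProduct.mk_apply, Algebra.TensorProduct.tmul_mul_tmul]
  exact tmul_mem_tensorSub (Submodule.mul_mem_mul ha hc) (Submodule.mul_mem_mul hb hd)

lemma mul_mem_tensorSub_top {X X' Z Y Y' : Submodule k L} {z w : L ⊗[k] L}
    (hz : z ∈ tensorSub X Y) (hw : w ∈ tensorSub X' Y') (h : X * X' ≤ Z) :
    z * w ∈ tensorSub Z ⊤ :=
  tensorSub_mono h le_top (tensorSub_mul_le _ _ _ _ (Submodule.mul_mem_mul hz hw))

/-- The contraction `a ⊗ b ↦ f b • a` of the second tensor factor. -/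
noncomputable def contract (f : Module.Dual k L) : L ⊗[k] L →ₗ[k] L :=
  (TensorProduct.rid k L).toLinearMap ∘ₗ LinearMap.lTensor L f

@[simp]
lemma contract_tmul (f : Module.Dual k L) (a b : L) : contract f (a ⊗ₜ[k] b) = f b • a := by
  simp [contract]

lemma contract_mem {X Y : Submodule k L} {z : L ⊗[k] L} (hz : z ∈ tensorSub X Y)
    (f : Module.Dual k L) : contract f z ∈ X := by
  have h : tensorSub X Y ≤ X.comap (contract f) :=
    Submodule.map₂_le.2 fun a ha b _ => by simpa using X.smul_mem _ ha
  exact h hz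

lemma contract_mem_of_vanish {X X' Y : Submodule k L} {z : L ⊗[k] L} {f : Module.Dual k L}
    (hf : ∀ b ∈ Y, f b = 0) (hz : z ∈ tensorSub X ⊤ ⊔ tensorSub X' Y) : contract f z ∈ X := by
  have h : tensorSub X ⊤ ⊔ tensorSub X' Y ≤ X.comap (contract f) :=
    sup_le (fun z hz => contract_mem hz f)
      (Submodule.map₂_le.2 fun a _ b hb => by simp [hf b hb])
  exact h hz

lemma contract_mul_tmul_one (f : Module.Dual k L) (z : L ⊗[k] L) (u : L) :
    contract f (z * u ⊗ₜ[k] 1) = contract f z * u := by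
  induction z using TensorProduct.induction_on with
  | zero => simp
  | tmul a b => simp
  | add a b ha hb => simp [add_mul, ha, hb]

lemma eq_zero_of_contract_eq_zero [FiniteDimensional k L] {z : L ⊗[k] L}
    (h : ∀ f : Module.Dual k L, contract f z = 0) : z = 0 := by
  let b := Module.finBasis k L
  have key : ∀ z : L ⊗[k] L, z = ∑ i, contract (b.coord i) z ⊗ₜ[k] b i := by
    intro z
    induction z using TensorProduct.induction_on with
    | zero => simp
    | tmul u v =>
      conv_lhs => rw [← b.sum_repr v, TensorProduct.tmul_sum]
      simp [TensorProduct.smul_tmul']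
    | add u v hu hv =>
      conv_lhs => rw [hu, hv]
      simp [TensorProduct.add_tmul, Finset.sum_add_distrib]
  rw [key z]
  simp [h]

end Contraction

section Triangular

variable {k L : Type*} [Field k] [Ring L] [Bialgebra k L]

open Coalgebra

/-- A subspace that can be built up one dimension at a time so that each new vector `b` satisfies
`Δ b ≡ b ⊗ h` for some `h ∈ Γ`, modulo the vectors already present in the first factor. -/
inductive Triangular (Γ : Set L) : Submodule k L → Prop
  | bot : Triangular Γ ⊥
  | step {V : Submodule k L} {b h : L} : Triangular Γ V → h ∈ Γ →
      comul (R := k) b - b ⊗ₜ[k] h ∈ tensorSub V ⊤ → Triangular Γ (V ⊔ Submodule.span k {b})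

namespace Triangular

variable {Γ Γ' Γ'' : Set L} {V W : Submodule k L}

lemma mono (hV : Triangular Γ V) (h : Γ ⊆ Γ') : Triangular Γ' V := by
  induction hV with
  | bot => exact bot
  | step _ hh hb ih => exact step ih (h hh) hb

lemma comul_mem (hV : Triangular Γ V) {v : L} (hv : v ∈ V) :
    comul (R := k) v ∈ tensorSub V ⊤ := by
  induction hV generalizing v with
  | bot =>
    obtain rfl : v = 0 := by simpa using hv
    simp
  | @step V b h _ _ hb ih =>
    obtain ⟨u, hu, _, hw, rfl⟩ := Submodule.mem_sup.1 hv
    obtain ⟨c, rfl⟩ := Submodule.mem_span_singleton.1 hw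
    rw [map_add, map_smul]
    refine add_mem (tensorSub_mono le_sup_left le_rfl (ih hu)) (Submodule.smul_mem _ _ ?_)
    rw [← sub_add_cancel (comul (R := k) b) (b ⊗ₜ[k] h)]
    exact add_mem (tensorSub_mono le_sup_left le_rfl hb) (tmul_mem_tensorSub
      (Submodule.mem_sup_right (Submodule.mem_span_singleton_self b)) trivial)

lemma span_singleton {h : L} (hh : IsGroupLikeElem k h) (hmem : h ∈ Γ) :
    Triangular Γ (Submodule.span k {h}) := by
  rw [← bot_sup_eq (Submodule.span k {h})]
  exact step bot hmem (by simp [hh.comul_eq_tmul_self])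

lemma sup (hV : Triangular Γ V) (hW : Triangular Γ W) : Triangular Γ (V ⊔ W) := by
  induction hW with
  | bot => simpa
  | step _ hh hb ih =>
    rw [← sup_assoc]
    exact step ih hh (tensorSub_mono le_sup_right le_rfl hb)

lemma mul (hV : Triangular Γ V) (hW : Triangular Γ' W)
    (hΓ : ∀ h ∈ Γ, ∀ h' ∈ Γ', h * h' ∈ Γ'') : Triangular Γ'' (V * W) := by
  induction hV with
  | bot => simpa using bot
  | @step V b h _ hh hb ih =>
    have aux : ∀ U : Submodule k L, Triangular Γ' U → U ≤ W →
        Triangular Γ'' (V * W ⊔ Submodule.span k {b} * U) := by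
      intro U hU
      induction hU with
      | bot => intro _; simpa
      | @step U b' h' hU hh' hb' ihU =>
        intro hle
        have hb'U : b' ∈ U ⊔ Submodule.span k {b'} :=
          Submodule.mem_sup_right (Submodule.mem_span_singleton_self b')
        rw [Submodule.mul_sup, Submodule.span_mul_span, Set.singleton_mul_singleton, ← sup_assoc]
        refine step (ihU (le_sup_left.trans hle)) (hΓ h hh h' hh') ?_
        have e : comul (R := k) (b * b') - (b * b') ⊗ₜ[k] (h * h') =
            (comul (R := k) b - b ⊗ₜ[k] h) * comul (R := k) b' +
              b ⊗ₜ[k] h * (comul (R := k) b' - b' ⊗ₜ[k] h') := by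
          rw [Bialgebra.comul_mul, sub_mul, mul_sub, Algebra.TensorProduct.tmul_mul_tmul]
          abel
        rw [e]
        refine add_mem ?_ ?_
        · exact mul_mem_tensorSub_top hb ((step hU hh' hb').comul_mem hb'U)
            ((mul_le_mul_right hle V).trans le_sup_left)
        · exact mul_mem_tensorSub_top (X := Submodule.span k {b}) (Y := ⊤)
            (tmul_mem_tensorSub (Submodule.mem_span_singleton_self b) trivial) hb' le_sup_right
    rw [Submodule.sup_mul]
    exact aux W hW le_rfl

/-- A right coideal meeting a triangular subspace contains one of its grouplikes. -/
lemma exists_mem_of_inf_ne_bot [FiniteDimensional k L] (hV : Triangular Γ V)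
    (hW : ∀ w ∈ W, ∀ f : Module.Dual k L, contract f (comul (R := k) w) ∈ W)
    (hne : W ⊓ V ≠ ⊥) : ∃ h ∈ Γ, h ∈ W := by
  induction hV with
  | bot => simp at hne
  | @step V b h hV hh hb ih =>
    by_cases hVW : W ⊓ V = ⊥
    swap
    · exact ih hVW
    obtain ⟨w, hw, hw0⟩ := Submodule.exists_mem_ne_zero_of_ne_bot hne
    obtain ⟨hwW, hwV⟩ := hw
    obtain ⟨v, hv, _, hcb, rfl⟩ := Submodule.mem_sup.1 hwV
    obtain ⟨c, rfl⟩ := Submodule.mem_span_singleton.1 hcb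
    set w := v + c • b
    have h1 : comul (R := k) w - w ⊗ₜ[k] h ∈ tensorSub V ⊤ := by
      have e : comul (R := k) w - w ⊗ₜ[k] h =
          comul (R := k) v - v ⊗ₜ[k] h + c • (comul (R := k) b - b ⊗ₜ[k] h) := by
        simp only [w, map_add, map_smul, TensorProduct.add_tmul, TensorProduct.smul_tmul', smul_sub]
        abel
      rw [e]
      exact add_mem (sub_mem (hV.comul_mem hv) (tmul_mem_tensorSub hv trivial))
        (Submodule.smul_mem _ _ hb)
    have h2 : comul (R := k) w = w ⊗ₜ[k] h := by
      refine sub_eq_zero.1 (eq_zero_of_contract_eq_zero fun f => ?_)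
      have h3 : contract f (comul (R := k) w - w ⊗ₜ[k] h) ∈ W ⊓ V := by
        refine ⟨?_, contract_mem h1 f⟩
        rw [map_sub, contract_tmul]
        exact sub_mem (hW w hwW f) (W.smul_mem _ hwW)
      rwa [hVW, Submodule.mem_bot] at h3
    have h3 : w = counit (R := k) w • h := by
      have := Coalgebra.rTensor_counit_comul (R := k) w
      rw [h2] at this
      simpa using (congrArg (TensorProduct.lid k L) this).symm
    have h4 : counit (R := k) w ≠ 0 := fun h0 => hw0 (by rw [h3, h0, zero_smul])
    refine ⟨h, hh, ?_⟩
    rw [h3] at hwW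
    exact (W.smul_mem_iff h4).1 hwW

end Triangular

end Triangular

open Coalgebra

section Triangular

variable {k L : Type*} [Field k] [Ring L] [Bialgebra k L]

lemma IsGrouplikeWrt.isGroupLikeElem {g : L} (hg : IsGrouplikeWrt k (comulL k L) g) :
    IsGroupLikeElem k g := by
  obtain ⟨h0, hΔ⟩ := hg
  refine ⟨?_, hΔ⟩
  have h1 := Coalgebra.rTensor_counit_comul (R := k) g
  rw [show comul (R := k) g = g ⊗ₜ[k] g from hΔ] at h1
  have h2 : counit (R := k) g • g = (1 : k) • g := by
    simpa using congrArg (TensorProduct.lid k L) h1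
  exact smul_left_injective k h0 h2

lemma isPointed_of_triangular [FiniteDimensional k L]
    (h : Triangular (k := k) {h : L | IsGroupLikeElem k h} ⊤) : IsPointed k L := by
  rintro C ⟨hC, hC0, hmin⟩
  obtain ⟨h, hh, hhC⟩ := h.exists_mem_of_inf_ne_bot (W := C)
    (fun w hw f => contract_mem (range_map_subtype C C ▸ hC w hw) f) (by simpa using hC0)
  have hle : Submodule.span k {h} ≤ C := by simpa using hhC
  have hsub : IsSubcoalgWrt k (comulL k L) (Submodule.span k {h}) := by
    intro x hx
    obtain ⟨c, rfl⟩ := Submodule.mem_span_singleton.1 hx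
    rw [range_map_subtype, map_smul, show comulL k L h = h ⊗ₜ[k] h from hh.comul_eq_tmul_self]
    exact Submodule.smul_mem _ _ (tmul_mem_tensorSub (Submodule.mem_span_singleton_self h)
      (Submodule.mem_span_singleton_self h))
  obtain hlt | heq := hle.lt_or_eq
  · have := hmin _ hsub hlt
    exact absurd (by simpa using this) hh.ne_zero
  · rw [← heq]
    exact finrank_span_singleton hh.ne_zero

lemma Triangular.adjoin [FiniteDimensional k L] {Γ : Submonoid L} {D : Submodule k L}
    (hD : Triangular (Γ : Set L) D) (h1 : 1 ∈ D) :
    Triangular (Γ : Set L) (Subalgebra.toSubmodule (Algebra.adjoin k (D : Set L))) := by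
  have hone : (1 : Submodule k L) ≤ D := Submodule.one_le.2 h1
  have hmono : Monotone (fun n : ℕ => D ^ n) :=
    monotone_nat_of_le_succ fun n => by
      simpa [pow_succ] using mul_le_mul' (le_refl (D ^ n)) hone
  have hpow : ∀ n : ℕ, Triangular (Γ : Set L) (D ^ n) := by
    intro n
    induction n with
    | zero =>
      rw [pow_zero, Submodule.one_eq_span]
      exact span_singleton IsGroupLikeElem.one Γ.one_mem
    | succ n ih => exact pow_succ D n ▸ ih.mul hD fun a ha b hb => Γ.mul_mem ha hb
  obtain ⟨n, hn⟩ := monotone_stabilizes_iff_noetherian.2 (inferInstance : IsNoetherian k L)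
    ⟨fun n : ℕ => D ^ n, hmono⟩
  replace hn : ∀ m, n ≤ m → D ^ n = D ^ m := hn
  have hDn : D ≤ D ^ n := by
    rw [hn (n + 1) n.le_succ]
    simpa using hmono (Nat.succ_le_succ n.zero_le)
  have hmul : D ^ n * D ^ n = D ^ n := by rw [← pow_add, ← hn (n + n) (by omega)]
  have heq : Subalgebra.toSubmodule (Algebra.adjoin k (D : Set L)) = D ^ n := by
    apply le_antisymm
    · let S : Subalgebra k L := (D ^ n).toSubalgebra (hDn h1)
        fun a b ha hb => hmul ▸ Submodule.mul_mem_mul ha hb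
      exact show Algebra.adjoin k (D : Set L) ≤ S from Algebra.adjoin_le hDn
    · have hle : D ≤ Subalgebra.toSubmodule (Algebra.adjoin k (D : Set L)) :=
        Algebra.subset_adjoin
      clear hn hDn hmul
      induction n with
      | zero => exact Submodule.one_le.2 (one_mem (Algebra.adjoin k (D : Set L)))
      | succ n ih =>
        rw [pow_succ]
        refine Submodule.mul_le.2 fun a ha b hb => ?_
        exact mul_mem (S := Subalgebra k L) (ih ha) (hle hb)
  rw [heq]
  exact hpow n

/-- If `u` generates a copy of a grouplike in `L / F` then `t ↦ t u` is injective on `T`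
modulo `F`. -/
lemma eq_zero_of_mul_mem [FiniteDimensional k L] {T : Subalgebra k L} {Γ : Submonoid L}
    (hT : Triangular (Γ : Set L) (Subalgebra.toSubmodule T))
    (hΓ : ∀ h ∈ Γ, ∃ h' ∈ T, h' * h = 1)
    {F : Submodule k L} {Γ' : Set L} (hF : Triangular Γ' F)
    (hTF : Subalgebra.toSubmodule T * F ≤ F)
    {u s s' : L} (hs : s * s' = 1) (hu : comul (R := k) u - u ⊗ₜ[k] s ∈ tensorSub F ⊤)
    (huF : u ∉ F) {t : L} (ht : t ∈ T) (htu : t * u ∈ F) : t = 0 := by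
  let I : Submodule k L := Subalgebra.toSubmodule T ⊓ F.comap (LinearMap.mulRight k u)
  have hI : ∀ w ∈ I, ∀ f : Module.Dual k L, contract f (comul (R := k) w) ∈ I := by
    rintro w ⟨hwT, hwF⟩ f
    have hΔw := hT.comul_mem hwT
    refine ⟨contract_mem hΔw f, ?_⟩
    have e : comul (R := k) w * u ⊗ₜ[k] 1 =
        (comul (R := k) (w * u) - comul (R := k) w * (comul (R := k) u - u ⊗ₜ[k] s)) *
          1 ⊗ₜ[k] s' := by
      rw [Bialgebra.comul_mul, mul_sub, sub_sub_cancel, mul_assoc]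
      simp [hs]
    have hmem : comul (R := k) w * u ⊗ₜ[k] 1 ∈ tensorSub F ⊤ := by
      rw [e]
      refine mul_mem_tensorSub_top (X' := 1) (Y' := ⊤)
        (sub_mem (hF.comul_mem (by simpa using hwF)) (mul_mem_tensorSub_top hΔw hu hTF))
        (tmul_mem_tensorSub (Submodule.one_le.1 le_rfl) trivial) (by rw [mul_one])
    simpa [contract_mul_tmul_one] using contract_mem hmem f
  by_contra ht0
  obtain ⟨h, hh, hhI⟩ := hT.exists_mem_of_inf_ne_bot (W := I) hI
    (Submodule.ne_bot_iff _ |>.2 ⟨t, ⟨⟨ht, by simpa using htu⟩, ht⟩, ht0⟩)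
  obtain ⟨h', hh'T, hh'⟩ := hΓ h hh
  have hhu : h * u ∈ F := by simpa using hhI.2
  apply huF
  rw [← one_mul u, ← hh', mul_assoc]
  exact hTF (Submodule.mul_mem_mul hh'T hhu)

lemma eq_top_of_filtration [FiniteDimensional k L] {p : ℕ} {T : Subalgebra k L}
    (hdim : Module.finrank k L = p ^ 3) (hT : Module.finrank k T = p ^ 2)
    (F : ℕ → Submodule k L) (u : ℕ → L) (hmono : ∀ n, F n ≤ F (n + 1))
    (hu : ∀ n, ∀ t ∈ T, t * u n ∈ F (n + 1))
    (hinj : ∀ n < p, ∀ t ∈ T, t * u n ∈ F n → t = 0) : F p = ⊤ := by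
  have key : ∀ n ≤ p, n * p ^ 2 ≤ Module.finrank k (F n) := by
    intro n hn
    induction n with
    | zero => simp
    | succ n ih =>
      let φ : T →ₗ[k] L := (LinearMap.mulRight k (u n)).domRestrict (Subalgebra.toSubmodule T)
      have hφ : ∀ t : T, φ t = t * u n := fun t => rfl
      have hker : Function.Injective φ := by
        rw [← LinearMap.ker_eq_bot, LinearMap.ker_eq_bot']
        intro t ht
        rw [hφ] at ht
        exact Subtype.ext (hinj n hn t t.2 (ht ▸ zero_mem _))
      have hinf : F n ⊓ LinearMap.range φ = ⊥ := by
        rw [eq_bot_iff]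
        rintro _ ⟨hxF, t, rfl⟩
        obtain rfl : t = 0 := Subtype.ext (hinj n hn t t.2 hxF)
        simp
      have hle : F n ⊔ LinearMap.range φ ≤ F (n + 1) := by
        refine sup_le (hmono n) ?_
        rintro _ ⟨t, rfl⟩
        exact hu n t t.2
      have h1 := Submodule.finrank_sup_add_finrank_inf_eq (F n) (LinearMap.range φ)
      rw [hinf, finrank_bot, LinearMap.finrank_range_of_inj hker, hT] at h1
      have h2 := Submodule.finrank_mono hle
      have h3 := ih (by omega)
      have h4 : (n + 1) * p ^ 2 = n * p ^ 2 + p ^ 2 := by ring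
      omega
  apply Submodule.eq_top_of_finrank_eq
  have h1 := key p le_rfl
  have h2 := Submodule.finrank_le (F p)
  have h3 : p * p ^ 2 = p ^ 3 := by ring
  omega

end Triangular

section Trace

variable {k L : Type*} [Field k] [Ring L] [HopfAlgebra k L]

/-- Multiplication by `u ⊗ u` on `L ⊗ L` is conjugate to multiplication by `u ⊗ 1`. -/
lemma trace_mulLeft_sq [FiniteDimensional k L] {u : L} (hu : IsGroupLikeElem k u) :
    LinearMap.trace k L (LinearMap.mulLeft k u) * LinearMap.trace k L (LinearMap.mulLeft k u) =
      LinearMap.trace k L (LinearMap.mulLeft k u) * Module.finrank k L := by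
  let Φ : L ⊗[k] L →ₗ[k] L ⊗[k] L := (LinearMap.mul' k L).lTensor L ∘ₗ
    (TensorProduct.assoc k L L L).toLinearMap ∘ₗ (comul (R := k) (A := L)).rTensor L
  let Ψ : L ⊗[k] L →ₗ[k] L ⊗[k] L :=
    (LinearMap.mul' k L ∘ₗ (HopfAlgebra.antipode k (A := L)).rTensor L).lTensor L ∘ₗ
    (TensorProduct.assoc k L L L).toLinearMap ∘ₗ (comul (R := k) (A := L)).rTensor L
  have hΦ : ∀ a b : L, Φ (a ⊗ₜ b) = comul (R := k) a * 1 ⊗ₜ b := by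
    intro a b
    simp only [Φ, LinearMap.comp_apply, LinearMap.rTensor_tmul, LinearEquiv.coe_coe]
    induction comul (R := k) a using TensorProduct.induction_on with
    | zero => simp
    | tmul x y => simp
    | add x y hx hy => simp only [TensorProduct.add_tmul, map_add, hx, hy, add_mul]
  have hΨmul : ∀ (z : L ⊗[k] L) (b : L), Ψ (z * 1 ⊗ₜ b) = Ψ z * 1 ⊗ₜ b := by
    intro z b
    induction z using TensorProduct.induction_on with
    | zero => simp
    | add x y hx hy => simp only [map_add, hx, hy, add_mul]
    | tmul x y =>
      simp only [Algebra.TensorProduct.tmul_mul_tmul, mul_one, Ψ, LinearMap.comp_apply,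
        LinearMap.rTensor_tmul, LinearEquiv.coe_coe]
      induction comul (R := k) x using TensorProduct.induction_on with
      | zero => simp
      | tmul x y => simp [mul_assoc]
      | add x y hx hy => simp only [TensorProduct.add_tmul, map_add, hx, hy, add_mul]
  have hΨΔ : ∀ a : L, Ψ (comul (R := k) a) = a ⊗ₜ 1 := by
    intro a
    simp only [Ψ, LinearMap.comp_apply, LinearEquiv.coe_coe]
    rw [Coalgebra.coassoc_apply, ← LinearMap.comp_apply, ← LinearMap.lTensor_comp,
      LinearMap.comp_assoc, HopfAlgebra.mul_antipode_rTensor_comul, LinearMap.lTensor_comp,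
      LinearMap.comp_apply, Coalgebra.lTensor_counit_comul]
    simp
  have hinj : Function.LeftInverse Ψ Φ := by
    intro z
    induction z using TensorProduct.induction_on with
    | zero => simp
    | tmul a b => rw [hΦ, hΨmul, hΨΔ]; simp
    | add x y hx hy => simp only [map_add, hx, hy]
  let e : (L ⊗[k] L) ≃ₗ[k] (L ⊗[k] L) := LinearEquiv.ofInjectiveEndo Φ hinj.injective
  have he : e.conj (TensorProduct.map (LinearMap.mulLeft k u) LinearMap.id) =
      TensorProduct.map (LinearMap.mulLeft k u) (LinearMap.mulLeft k u) := by
    have hmul : ∀ z : L ⊗[k] L,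
        TensorProduct.map (LinearMap.mulLeft k u) (LinearMap.mulLeft k u) z =
        u ⊗ₜ u * z := by
      intro z
      induction z using TensorProduct.induction_on with
      | zero => simp
      | tmul a b => simp
      | add x y hx hy => simp only [map_add, hx, hy, mul_add]
    refine LinearMap.ext fun z => ?_
    obtain ⟨w, rfl⟩ := e.surjective z
    rw [LinearEquiv.conj_apply_apply, LinearEquiv.symm_apply_apply, hmul]
    change Φ _ = _ * Φ w
    induction w using TensorProduct.induction_on with
    | zero => simp
    | tmul a b =>
      rw [TensorProduct.map_tmul, LinearMap.mulLeft_apply, LinearMap.id_apply, hΦ, hΦ,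
        Bialgebra.comul_mul, hu.comul_eq_tmul_self, mul_assoc]
    | add x y hx hy => simp only [map_add, hx, hy, mul_add]
  have := LinearMap.trace_conj' (TensorProduct.map (LinearMap.mulLeft k u) LinearMap.id) e
  rw [he, LinearMap.trace_tensorProduct', LinearMap.trace_tensorProduct', LinearMap.trace_id]
    at this
  exact this

lemma prime_dvd_finrank [CharZero k] [FiniteDimensional k L] {u : L} (hu : IsGroupLikeElem k u)
    {l : ℕ} (hl : l.Prime) (hul : u ^ l = 1) (hu1 : u ≠ 1) : l ∣ Module.finrank k L := by
  classical
  by_contra hn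
  set n := Module.finrank k L with hn_def
  have hlk : (l : k) ≠ 0 := Nat.cast_ne_zero.2 hl.ne_zero
  set e : L := (l : k)⁻¹ • ∑ j ∈ Finset.range l, u ^ j with he_def
  have hue : u * e = e := by
    rw [he_def, mul_smul_comm]
    congr 1
    have h1 := Finset.sum_range_succ (fun j => u ^ j) l
    rw [Finset.sum_range_succ', hul, pow_zero] at h1
    rw [Finset.mul_sum]
    simpa [pow_succ'] using h1
  have hpe : ∀ j, u ^ j * e = e := by
    intro j
    induction j with
    | zero => simp
    | succ j ih => rw [pow_succ, mul_assoc, hue, ih]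
  have hee : e * e = e := by
    conv_lhs => rw [he_def]
    rw [smul_mul_assoc, Finset.sum_mul, Finset.sum_congr rfl fun j _ => hpe j]
    simp [← Nat.cast_smul_eq_nsmul k, smul_smul, hlk]
  let χ : ℕ → k := fun j => LinearMap.trace k L (LinearMap.mulLeft k (u ^ j))
  have hχ : ∀ j, χ j = if χ j = n then (n : k) else 0 := by
    intro j
    split_ifs with h
    · exact h
    · have h1 := trace_mulLeft_sq (hu.pow (n := j))
      have h2 : χ j * (χ j - n) = 0 := by rw [mul_sub, sub_eq_zero]; exact h1
      exact (mul_eq_zero.1 h2).resolve_right (sub_ne_zero.2 h)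
  set s := (Finset.range l).filter fun j => χ j = n with hs
  have hs_pos : 0 < s.card := by
    refine Finset.card_pos.2 ⟨0, Finset.mem_filter.2 ⟨Finset.mem_range.2 hl.pos, ?_⟩⟩
    have : LinearMap.mulLeft k (1 : L) = LinearMap.id := by ext; simp
    simp only [χ, pow_zero, this, LinearMap.trace_id]
    rfl
  have hs_le : s.card ≤ l := (Finset.card_filter_le _ _).trans (Finset.card_range l).le
  have hidem : IsIdempotentElem (LinearMap.mulLeft k e) := by
    ext x
    simp [← mul_assoc, hee]
  have htr : LinearMap.trace k L (LinearMap.mulLeft k e) = (l : k)⁻¹ * (s.card * n) := by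
    have : LinearMap.mulLeft k e =
        (l : k)⁻¹ • ∑ j ∈ Finset.range l, LinearMap.mulLeft k (u ^ j) := by
      ext x
      simp [he_def, LinearMap.sum_apply, Finset.sum_mul]
    rw [this, map_smul, map_sum, smul_eq_mul]
    congr 1
    rw [Finset.sum_congr rfl fun j _ => hχ j, ← Finset.sum_filter, Finset.sum_const, nsmul_eq_mul]
  have htr' := (LinearMap.IsIdempotentElem.isProj_range _ hidem).trace
  set r := Module.finrank k (LinearMap.range (LinearMap.mulLeft k e)) with hr
  have hcount : l * r = s.card * n := by
    rw [htr'] at htr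
    have : (l : k) * r = s.card * n := by rw [htr]; field_simp
    exact_mod_cast this
  have hdvd : l ∣ s.card :=
    (hl.dvd_mul.1 (hcount ▸ Dvd.intro r rfl : l ∣ s.card * n)).resolve_right hn
  have hsl : s.card = l := le_antisymm hs_le (Nat.le_of_dvd hs_pos hdvd)
  have hrn : r = n := by
    rw [hsl] at hcount
    exact Nat.eq_of_mul_eq_mul_left hl.pos hcount
  have htop := Submodule.eq_top_of_finrank_eq (hr.symm.trans hrn)
  obtain ⟨z, hz⟩ := LinearMap.range_eq_top.1 htop 1
  replace hz : e * z = 1 := hz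
  have he1 : e = 1 := by rw [← hz]; nth_rewrite 2 [← hee]; rw [mul_assoc, hz, mul_one]
  exact hu1 (by rw [he1, mul_one] at hue; exact hue)

lemma mem_powers_of_pow_mem [CharZero k] [FiniteDimensional k L] {p : ℕ} (hp : p.Prime)
    (hdim : Module.finrank k L = p ^ 3) {g c : L} (hg : IsGroupLikeElem k g) {d : ℕ} (hd0 : 0 < d)
    (hdp : d < p) (hgd : g ^ d ∈ Submonoid.powers c) : g ∈ Submonoid.powers c := by
  have hfin : Finite (GroupLike k L) := (linearIndep_groupLikeVal (R := k) (A := L)).finite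
  let γ : GroupLike k L := ⟨g, hg⟩
  set N := orderOf γ with hN
  have hN0 : 0 < N := orderOf_pos γ
  have hprime : ∀ l : ℕ, l.Prime → l ∣ N → l = p := by
    intro l hl hlN
    have h1 : (γ ^ (N / l)) ^ l = 1 := by
      rw [← pow_mul, Nat.div_mul_cancel hlN, pow_orderOf_eq_one]
    have h2 : γ ^ (N / l) ≠ 1 :=
      pow_ne_one_of_lt_orderOf (Nat.div_pos (Nat.le_of_dvd hN0 hlN) hl.pos).ne'
        (Nat.div_lt_self hN0 hl.one_lt)
    have h3 := prime_dvd_finrank (γ ^ (N / l)).2 hl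
      (by simpa using congrArg GroupLike.val h1) (fun h => h2 (GroupLike.val_injective h))
    rw [hdim] at h3
    exact (Nat.prime_dvd_prime_iff_eq hl hp).1 (hl.dvd_of_dvd_pow h3)
  have hcop : d.Coprime N := by
    by_contra hc
    obtain ⟨l, hl, hld, hlN⟩ := Nat.Prime.not_coprime_iff_dvd.1 hc
    have := Nat.le_of_dvd hd0 hld
    rw [hprime l hl hlN] at this
    omega
  obtain ⟨m, hm⟩ := exists_pow_eq_self_of_coprime (x := γ) (n := d) hcop
  have hgm : (g ^ d) ^ m = g := by simpa [γ] using congrArg GroupLike.val hm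
  rw [← hgm]
  exact Submonoid.pow_mem _ hgd m

end Trace

section Taft

variable {k L : Type*} [Field k] [Ring L] [Bialgebra k L]

lemma triangular_adjoin_pair [FiniteDimensional k L] {c x : L} (hc : IsGroupLikeElem k c)
    (hx : comul (R := k) x = x ⊗ₜ[k] (1 : L) + c ⊗ₜ[k] x) :
    Triangular (Submonoid.powers c : Set L)
      (Subalgebra.toSubmodule (Algebra.adjoin k {c, x})) := by
  set D : Submodule k L := Submodule.span k {1} ⊔ Submodule.span k {c} ⊔ Submodule.span k {x}
  have h1D : (1 : L) ∈ D := Submodule.mem_sup_left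
    (Submodule.mem_sup_left (Submodule.mem_span_singleton_self 1))
  have hcD : c ∈ D := Submodule.mem_sup_left
    (Submodule.mem_sup_right (Submodule.mem_span_singleton_self c))
  have hxD : x ∈ D := Submodule.mem_sup_right (Submodule.mem_span_singleton_self x)
  have hD : Triangular (Submonoid.powers c : Set L) D := by
    refine Triangular.step ((Triangular.span_singleton IsGroupLikeElem.one (one_mem _)).sup
      (Triangular.span_singleton hc (Submonoid.mem_powers c))) (one_mem (Submonoid.powers c)) ?_
    rw [hx, add_sub_cancel_left]
    exact tmul_mem_tensorSub (Submodule.mem_sup_right (Submodule.mem_span_singleton_self c)) trivial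
  have heq : Algebra.adjoin k {c, x} = Algebra.adjoin k (D : Set L) := by
    refine le_antisymm (Algebra.adjoin_mono (Set.insert_subset hcD (by simpa using hxD))) ?_
    refine Algebra.adjoin_le (show D ≤ Subalgebra.toSubmodule (Algebra.adjoin k {c, x}) from ?_)
    simp only [D, sup_le_iff, Submodule.span_singleton_le_iff_mem, Subalgebra.mem_toSubmodule]
    exact ⟨⟨one_mem _, Algebra.subset_adjoin (by simp)⟩, Algebra.subset_adjoin (by simp)⟩
  rw [heq]
  exact hD.adjoin h1D

lemma comul_mem_adjoin_pair {c x : L} (hc : IsGroupLikeElem k c)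
    (hx : comul (R := k) x = x ⊗ₜ[k] (1 : L) + c ⊗ₜ[k] x) {t : L}
    (ht : t ∈ Algebra.adjoin k {c, x}) :
    comul (R := k) t ∈ tensorSub (Subalgebra.toSubmodule (Algebra.adjoin k {c, x}))
      (Subalgebra.toSubmodule (Algebra.adjoin k {c, x})) := by
  set T := Algebra.adjoin k {c, x}
  have hcT : c ∈ T := Algebra.subset_adjoin (by simp)
  have hxT : x ∈ T := Algebra.subset_adjoin (by simp)
  induction ht using Algebra.adjoin_induction with
  | mem u hu =>
    obtain rfl | rfl := hu
    · rw [hc.comul_eq_tmul_self]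
      exact tmul_mem_tensorSub hcT hcT
    · rw [hx]
      exact add_mem (tmul_mem_tensorSub hxT (one_mem T)) (tmul_mem_tensorSub hcT hxT)
  | algebraMap r =>
    rw [Bialgebra.comul_algebraMap, Algebra.TensorProduct.algebraMap_apply]
    exact tmul_mem_tensorSub (T.algebraMap_mem r) (one_mem T)
  | add u v _ _ hu hv => rw [map_add]; exact add_mem hu hv
  | mul u v _ _ hu hv =>
    have := tensorSub_mul_le _ _ _ _ (Submodule.mul_mem_mul hu hv)
    rwa [Subalgebra.isIdempotentElem_toSubmodule, ← Bialgebra.comul_mul] at this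

end Taft

section Eigenvector

variable {k L : Type*} [Field k] [IsAlgClosed k] [CharZero k] [Ring L] [Bialgebra k L]
  [FiniteDimensional k L]

lemma exists_conj_eigenvector {p : ℕ} (hp : 0 < p) {T : Subalgebra k L} {g y : L}
    (hg : IsGroupLikeElem k g) (hgT : g ∈ T) (hgp : g ^ p = 1) (hy : y ∉ T)
    (hΔ : comul (R := k) y - g ⊗ₜ[k] y - y ⊗ₜ[k] 1 ∈
      tensorSub (Subalgebra.toSubmodule T) (Subalgebra.toSubmodule T)) :
    ∃ (v : L) (ν : k), v ∉ T ∧ ν ^ p = 1 ∧ g * v = ν • (v * g) ∧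
      comul (R := k) v - g ⊗ₜ[k] v - v ⊗ₜ[k] 1 ∈
        tensorSub (Subalgebra.toSubmodule T) (Subalgebra.toSubmodule T) := by
  set τ := Subalgebra.toSubmodule T
  let δ : L →ₗ[k] L ⊗[k] L := comul - TensorProduct.mk k L L g - (TensorProduct.mk k L L).flip 1
  have hδ : ∀ v, δ v = comul (R := k) v - g ⊗ₜ[k] v - v ⊗ₜ[k] 1 := fun v => rfl
  let V : Submodule k L := (tensorSub τ τ).comap δ
  let g' := g ^ (p - 1)
  have hg' : IsGroupLikeElem k g' := hg.pow
  have hg'T : g' ∈ T := pow_mem hgT _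
  have hgg' : g * g' = 1 := by rw [← pow_succ', Nat.sub_add_cancel hp, hgp]
  have hg'g : g' * g = 1 := by rw [← pow_succ, Nat.sub_add_cancel hp, hgp]
  let φ : Module.End k L := LinearMap.mulLeft k g ∘ₗ LinearMap.mulRight k g'
  have hφ : ∀ v, φ v = g * (v * g') := fun v => rfl
  have hφV : ∀ v ∈ V, φ v ∈ V := by
    intro v hv
    change δ (φ v) ∈ tensorSub τ τ
    have e : δ (φ v) = g ⊗ₜ g * (δ v * g' ⊗ₜ g') := by
      simp only [hδ, hφ, Bialgebra.comul_mul, hg.comul_eq_tmul_self, hg'.comul_eq_tmul_self,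
        sub_mul, mul_sub, Algebra.TensorProduct.tmul_mul_tmul, hgg', one_mul, mul_one]
    have := tensorSub_mul_le _ _ _ _ (Submodule.mul_mem_mul (tmul_mem_tensorSub (X := τ) (Y := τ)
      hgT hgT) (tensorSub_mul_le _ _ _ _ (Submodule.mul_mem_mul (show δ v ∈ tensorSub τ τ from hv)
        (tmul_mem_tensorSub (X := τ) (Y := τ) hg'T hg'T))))
    rwa [T.isIdempotentElem_toSubmodule.eq, T.isIdempotentElem_toSubmodule.eq, ← e] at this
  have hφpow : ∀ n v, (φ ^ n) v = g ^ n * (v * g' ^ n) := by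
    intro n
    induction n with
    | zero => simp
    | succ n ih =>
      intro v
      rw [pow_succ', Module.End.mul_apply, ih, hφ, pow_succ', pow_succ]
      simp only [mul_assoc]
  have hφp : φ ^ p = 1 := by
    refine LinearMap.ext fun v => ?_
    rw [hφpow, hgp, ← pow_mul, mul_comm (p - 1), pow_mul, hgp]
    simp
  let ψ : Module.End k V := φ.restrict hφV
  have hψ : ψ ^ p = 1 := by
    refine LinearMap.ext fun v => Subtype.ext ?_
    rw [Module.End.pow_restrict]
    simp [hφp]
  have hss : ψ.IsSemisimple := by
    have hsep : (Polynomial.X ^ p - 1 : Polynomial k).Separable :=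
      Polynomial.X_pow_sub_one_separable_iff.2 (Nat.cast_ne_zero.2 hp.ne')
    exact Module.End.isSemisimple_of_squarefree_aeval_eq_zero hsep.squarefree (by simp [hψ])
  have htop : ⨆ μ, ψ.eigenspace μ = ⊤ := by
    have := Module.End.iSup_maxGenEigenspace_eq_top ψ
    simpa only [hss.isFinitelySemisimple.maxGenEigenspace_eq_eigenspace] using this
  have hex : ∃ μ, ¬ ψ.eigenspace μ ≤ τ.comap V.subtype := by
    by_contra! hall
    have h1 : (⟨y, hΔ⟩ : V) ∈ (⊤ : Submodule k V) := trivial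
    rw [← htop] at h1
    exact hy (iSup_le hall h1)
  obtain ⟨ν, hν⟩ := hex
  obtain ⟨⟨v, hvV⟩, hv, hvT⟩ := SetLike.not_le_iff_exists.1 hν
  replace hvT : v ∉ T := hvT
  have hv1 : φ v = ν • v := congrArg Subtype.val (Module.End.mem_eigenspace_iff.1 hv)
  have hv0 : v ≠ 0 := fun h => hvT (h ▸ zero_mem T)
  refine ⟨v, ν, hvT, ?_, ?_, hvV⟩
  · have h1 : ∀ n : ℕ, (φ ^ n) v = ν ^ n • v := by
      intro n
      induction n with
      | zero => simp
      | succ n ih => rw [pow_succ, Module.End.mul_apply, hv1, map_smul, ih, smul_smul, pow_succ']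
    have h2 := h1 p
    rw [hφp, Module.End.one_apply] at h2
    exact (smul_left_injective k hv0 (by simpa using h2)).symm
  · rw [← smul_mul_assoc, ← hv1, hφ, mul_assoc, mul_assoc, hg'g, mul_one]

end Eigenvector

section Grouplike

variable {k L : Type*} [Field k] [CharZero k] [Ring L] [HopfAlgebra k L] [FiniteDimensional k L]

lemma isPointed_of_grouplike_not_mem {p : ℕ} (hp : p.Prime) (hdim : Module.finrank k L = p ^ 3)
    {T : Subalgebra k L} (hTdim : Module.finrank k T = p ^ 2) {c : L} (hc : IsGroupLikeElem k c)
    (hT : Triangular (Submonoid.powers c : Set L) (Subalgebra.toSubmodule T))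
    (hinv : ∀ h ∈ Submonoid.powers c, ∃ h' ∈ T, h' * h = 1)
    {g : L} (hg : IsGroupLikeElem k g) (hgc : g ∉ Submonoid.powers c) : IsPointed k L := by
  set τ := Subalgebra.toSubmodule T
  let F : ℕ → Submodule k L := fun n => Nat.rec ⊥ (fun n V => V ⊔ τ * Submodule.span k {g ^ n}) n
  have hF : ∀ n, F (n + 1) = F n ⊔ τ * Submodule.span k {g ^ n} := fun n => rfl
  let Γ : ℕ → Set L := fun n => {h | ∃ j < n, ∃ a ∈ Submonoid.powers c, h = a * g ^ j}
  have hΓ : ∀ n, ∀ h ∈ Γ n, IsGroupLikeElem k h := by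
    rintro n _ ⟨j, _, _, ⟨i, rfl⟩, rfl⟩
    exact hc.pow.mul hg.pow
  have hFtri : ∀ n, Triangular (Γ n) (F n) := by
    intro n
    induction n with
    | zero => exact Triangular.bot
    | succ n ih =>
      refine (ih.mono ?_).sup (hT.mul (Triangular.span_singleton (Γ := {g ^ n}) hg.pow rfl) ?_)
      · rintro h ⟨j, hj, hh⟩
        exact ⟨j, by omega, hh⟩
      · rintro h hh _ rfl
        exact ⟨n, by omega, h, hh, rfl⟩
  have hTF : ∀ n, τ * F n ≤ F n := by
    intro n
    induction n with
    | zero => simp [F]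
    | succ n ih =>
      rw [hF, Submodule.mul_sup, ← mul_assoc, Subalgebra.isIdempotentElem_toSubmodule]
      exact sup_le_sup_right ih _
  have hnot : ∀ n < p, g ^ n ∉ F n := by
    intro n hn hmem
    obtain ⟨h, ⟨j, hj, a, ha, rfl⟩, hmem'⟩ := (hFtri n).exists_mem_of_inf_ne_bot
      (W := Submodule.span k {g ^ n})
      (by
        intro w hw f
        obtain ⟨r, rfl⟩ := Submodule.mem_span_singleton.1 hw
        rw [map_smul, hg.pow.comul_eq_tmul_self, map_smul, contract_tmul]
        exact Submodule.smul_mem _ _ (Submodule.smul_mem _ _ (Submodule.mem_span_singleton_self _)))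
      (Submodule.ne_bot_iff _ |>.2
        ⟨g ^ n, ⟨Submodule.mem_span_singleton_self _, hmem⟩, hg.pow.ne_zero⟩)
    obtain ⟨r, hr⟩ := Submodule.mem_span_singleton.1 hmem'
    have hr1 : r = 1 := by
      have := congrArg (counit (R := k)) hr
      rw [map_smul, hg.pow.counit_eq_one, (hΓ n _ ⟨j, hj, a, ha, rfl⟩).counit_eq_one] at this
      simpa using this
    rw [hr1, one_smul, ← Nat.sub_add_cancel hj.le, pow_add] at hr
    have hga : g ^ (n - j) = a := (hg.pow (n := j)).isUnit.mul_right_cancel hr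
    exact hgc (mem_powers_of_pow_mem hp hdim hg (Nat.sub_pos_of_lt hj) (by omega) (hga ▸ ha))
  have htop : F p = ⊤ := by
    refine eq_top_of_filtration hdim hTdim F (fun n => g ^ n) (fun n => le_sup_left) ?_ ?_
    · intro n t ht
      exact Submodule.mem_sup_right
        (Submodule.mul_mem_mul ht (Submodule.mem_span_singleton_self _))
    · intro n hn t ht htu
      refine eq_zero_of_mul_mem hT hinv (hFtri n) (hTF n)
        (hg.pow (n := n)).mul_antipode_cancel ?_ (hnot n hn) ht htu
      simp [hg.pow.comul_eq_tmul_self]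
  exact isPointed_of_triangular (htop ▸ (hFtri p).mono (hΓ p))

end Grouplike

section Adjunction

variable {k L : Type*} [Field k] [Ring L] [Bialgebra k L]

/-- The subspace spanned by `T` and `y`. -/
def adjunction (T : Subalgebra k L) (y : L) : Submodule k L :=
  T.toSubmodule ⊔ Submodule.span k {y}

/-- The filtration of the subalgebra generated by `T` and `y` by degree in `y`, starting with `⊥`
at `0` and with `T` at `1`. -/
def degreeFiltration (T : Subalgebra k L) (y : L) : ℕ → Submodule k L
  | 0 => ⊥
  | n + 1 => T.toSubmodule * (adjunction T y * T.toSubmodule) ^ n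

namespace degreeFiltration

variable (T : Subalgebra k L) (y : L)


lemma one_le_toSubmodule : (1 : Submodule k L) ≤ T.toSubmodule := Submodule.one_le.2 (one_mem T)

lemma zero_eq : degreeFiltration T y 0 = ⊥ := rfl

lemma one_eq : degreeFiltration T y 1 = T.toSubmodule := by simp [degreeFiltration]

lemma succ_succ (n : ℕ) : degreeFiltration T y (n + 2) =
    degreeFiltration T y (n + 1) * (adjunction T y * T.toSubmodule) := by
  simp only [degreeFiltration, pow_succ, mul_assoc]

lemma mul_toSubmodule_le (n : ℕ) : degreeFiltration T y n * T.toSubmodule ≤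
    degreeFiltration T y n := by
  match n with
  | 0 => simp [zero_eq]
  | 1 => rw [one_eq, Subalgebra.isIdempotentElem_toSubmodule]
  | n + 2 => rw [succ_succ, mul_assoc, mul_assoc, Subalgebra.isIdempotentElem_toSubmodule]

lemma toSubmodule_mul_le (n : ℕ) : T.toSubmodule * degreeFiltration T y n ≤
    degreeFiltration T y n := by
  match n with
  | 0 => simp [zero_eq]
  | n + 1 => rw [degreeFiltration, ← mul_assoc, Subalgebra.isIdempotentElem_toSubmodule]

lemma mul_adjunction_le (n : ℕ) : degreeFiltration T y n * adjunction T y ≤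
    degreeFiltration T y (n + 1) := by
  match n with
  | 0 => simp [zero_eq]
  | n + 1 =>
    rw [succ_succ, ← mul_assoc]
    simpa using mul_le_mul' (le_refl (degreeFiltration T y (n + 1) * adjunction T y))
      (one_le_toSubmodule T)

lemma le_succ (n : ℕ) : degreeFiltration T y n ≤ degreeFiltration T y (n + 1) := by
  have h : 1 ≤ adjunction T y := (one_le_toSubmodule T).trans le_sup_left
  refine le_trans ?_ (mul_adjunction_le T y n)
  simpa using mul_le_mul' (le_refl (degreeFiltration T y n)) h

lemma mul_mem {n : ℕ} {a t : L} (ha : a ∈ degreeFiltration T y n) (ht : t ∈ T) :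
    a * t ∈ degreeFiltration T y n :=
  mul_toSubmodule_le T y n (Submodule.mul_mem_mul ha ht)

lemma pow_mem (n : ℕ) : y ^ n ∈ degreeFiltration T y (n + 1) := by
  induction n with
  | zero => rw [pow_zero, one_eq]; exact one_mem T
  | succ n ih =>
    rw [pow_succ]
    exact mul_adjunction_le T y (n + 1) (Submodule.mul_mem_mul ih
      (Submodule.mem_sup_right (Submodule.mem_span_singleton_self y)))

lemma triangular {Γ : Submonoid L} (hT : Triangular (Γ : Set L) T.toSubmodule)
    (hE : Triangular (Γ : Set L) (adjunction T y)) (n : ℕ) :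
    Triangular (Γ : Set L) (degreeFiltration T y n) := by
  have hmul : ∀ a ∈ (Γ : Set L), ∀ b ∈ (Γ : Set L), a * b ∈ (Γ : Set L) :=
    fun a ha b hb => Γ.mul_mem ha hb
  match n with
  | 0 => exact Triangular.bot
  | 1 => rwa [one_eq]
  | n + 2 =>
    rw [succ_succ]
    exact (triangular hT hE (n + 1)).mul (hE.mul hT hmul) hmul

/-- A subspace of `L ⊗ L` containing the comultiplications of filtered degree `n + 1`; its second
factors leave `T` only when the first factors have filtered degree `n`. -/
def tensorPart (n : ℕ) : Submodule k (L ⊗[k] L) :=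
  tensorSub (degreeFiltration T y n) ⊤ ⊔ tensorSub (degreeFiltration T y (n + 1)) T.toSubmodule

lemma tensorPart_mul_le (n : ℕ) :
    tensorPart T y n * (tensorSub T.toSubmodule ⊤ ⊔ tensorSub (adjunction T y) T.toSubmodule) ≤
      tensorPart T y (n + 1) := by
  rw [tensorPart, Submodule.sup_mul, Submodule.mul_sup, Submodule.mul_sup]
  refine sup_le (sup_le ?_ ?_) (sup_le ?_ ?_) <;> refine (tensorSub_mul_le _ _ _ _).trans ?_
  · exact (tensorSub_mono ((mul_toSubmodule_le T y n).trans (le_succ T y n)) le_top).trans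
      le_sup_left
  · exact (tensorSub_mono (mul_adjunction_le T y n) le_top).trans le_sup_left
  · exact (tensorSub_mono (mul_toSubmodule_le T y (n + 1)) le_top).trans le_sup_left
  · exact (tensorSub_mono (mul_adjunction_le T y (n + 1))
      T.isIdempotentElem_toSubmodule.eq.le).trans
      le_sup_right

lemma tensorPart_mul_tensorSub_le (n : ℕ) :
    tensorPart T y n * tensorSub T.toSubmodule T.toSubmodule ≤ tensorPart T y n := by
  rw [tensorPart, Submodule.sup_mul]
  refine sup_le ?_ ?_ <;> refine (tensorSub_mul_le _ _ _ _).trans ?_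
  · exact (tensorSub_mono (mul_toSubmodule_le T y n) le_top).trans le_sup_left
  · exact (tensorSub_mono (mul_toSubmodule_le T y (n + 1))
      T.isIdempotentElem_toSubmodule.eq.le).trans
      le_sup_right

variable {T y} {g : L}

lemma comul_mem_of_mem_adjunction (hT : ∀ t ∈ T, comul (R := k) t ∈ tensorSub T.toSubmodule T.toSubmodule)
    (hgT : g ∈ T)
    (hΔ : comul (R := k) y - g ⊗ₜ[k] y - y ⊗ₜ[k] 1 ∈ tensorSub T.toSubmodule T.toSubmodule)
    {m : L} (hm : m ∈ adjunction T y) :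
    comul (R := k) m ∈ tensorSub T.toSubmodule ⊤ ⊔ tensorSub (adjunction T y) T.toSubmodule := by
  have hle : tensorSub T.toSubmodule T.toSubmodule ≤
      tensorSub T.toSubmodule ⊤ ⊔ tensorSub (adjunction T y) T.toSubmodule :=
    (tensorSub_mono le_rfl le_top).trans le_sup_left
  obtain ⟨t, ht, _, hw, rfl⟩ := Submodule.mem_sup.1 hm
  obtain ⟨r, rfl⟩ := Submodule.mem_span_singleton.1 hw
  rw [map_add, map_smul]
  refine add_mem (hle (hT t ht)) (Submodule.smul_mem _ _ ?_)
  have e : comul (R := k) y =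
      (comul (R := k) y - g ⊗ₜ[k] y - y ⊗ₜ[k] 1) + g ⊗ₜ[k] y + y ⊗ₜ[k] 1 := by abel
  rw [e]
  refine add_mem (add_mem (hle hΔ) (Submodule.mem_sup_left (tmul_mem_tensorSub hgT trivial)))
    (Submodule.mem_sup_right (tmul_mem_tensorSub
      (Submodule.mem_sup_right (Submodule.mem_span_singleton_self y)) (one_mem T)))

lemma comul_mem (hT : ∀ t ∈ T, comul (R := k) t ∈ tensorSub T.toSubmodule T.toSubmodule)
    (hgT : g ∈ T)
    (hΔ : comul (R := k) y - g ⊗ₜ[k] y - y ⊗ₜ[k] 1 ∈ tensorSub T.toSubmodule T.toSubmodule)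
    (n : ℕ) {v : L}
    (hv : v ∈ degreeFiltration T y (n + 1)) : comul (R := k) v ∈ tensorPart T y n := by
  induction n generalizing v with
  | zero =>
    rw [one_eq] at hv
    refine Submodule.mem_sup_right ?_
    rw [one_eq]
    exact hT v hv
  | succ n ih =>
    have hle : degreeFiltration T y (n + 2) ≤
        (tensorPart T y (n + 1)).comap (comul (R := k) (A := L)) := by
      rw [succ_succ, ← mul_assoc]
      refine Submodule.mul_le.2 fun a ha t ht => ?_
      have h1 : degreeFiltration T y (n + 1) * adjunction T y ≤
          (tensorPart T y (n + 1)).comap (comul (R := k) (A := L)) := by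
        refine Submodule.mul_le.2 fun a ha m hm => ?_
        rw [Submodule.mem_comap, Bialgebra.comul_mul]
        exact tensorPart_mul_le T y n
          (Submodule.mul_mem_mul (ih ha) (comul_mem_of_mem_adjunction hT hgT hΔ hm))
      rw [Submodule.mem_comap, Bialgebra.comul_mul]
      exact tensorPart_mul_tensorSub_le T y (n + 1) (Submodule.mul_mem_mul (h1 ha) (hT t ht))
    exact hle hv

lemma comul_pow_mem (hT : ∀ t ∈ T, comul (R := k) t ∈ tensorSub T.toSubmodule T.toSubmodule)
    (hgT : g ∈ T)
    (hΔ : comul (R := k) y - g ⊗ₜ[k] y - y ⊗ₜ[k] 1 ∈ tensorSub T.toSubmodule T.toSubmodule) {ν : k}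
    (hν : g * y = ν • (y * g)) (n : ℕ) :
    comul (R := k) (y ^ (n + 1)) - (y ^ (n + 1)) ⊗ₜ[k] 1 -
      (∑ i ∈ Finset.range (n + 1), ν ^ i) • (y ^ n * g) ⊗ₜ[k] y ∈ tensorPart T y n := by
  set w := comul (R := k) y - g ⊗ₜ[k] y - y ⊗ₜ[k] 1 with hw
  have hΔy : comul (R := k) y = g ⊗ₜ[k] y + y ⊗ₜ[k] 1 + w := by rw [hw]; abel
  induction n with
  | zero =>
    refine Submodule.mem_sup_right ?_
    rw [one_eq]
    convert hΔ using 1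
    simp only [zero_add, pow_one, Finset.range_one, Finset.sum_singleton, pow_zero, one_smul,
      one_mul, hw]
    abel
  | succ n ih =>
    set s := ∑ i ∈ Finset.range (n + 1), ν ^ i
    rw [geom_sum_succ]
    have hlin : (y ^ n * g) ⊗ₜ[k] y * y ⊗ₜ[k] (1 : L) = ν • (y ^ (n + 1) * g) ⊗ₜ[k] y := by
      rw [Algebra.TensorProduct.tmul_mul_tmul, mul_one, mul_assoc, hν, mul_smul_comm, ← mul_assoc,
        ← pow_succ, TensorProduct.smul_tmul']
    have e : comul (R := k) (y ^ (n + 1 + 1)) - (y ^ (n + 1 + 1)) ⊗ₜ[k] 1 -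
        (ν * s + 1) • (y ^ (n + 1) * g) ⊗ₜ[k] y =
        (comul (R := k) (y ^ (n + 1)) - (y ^ (n + 1)) ⊗ₜ[k] 1 - s • (y ^ n * g) ⊗ₜ[k] y) *
          comul (R := k) y + (y ^ (n + 1)) ⊗ₜ[k] 1 * w +
          s • ((y ^ n * g) ⊗ₜ[k] y * (g ⊗ₜ[k] y + w)) := by
      have h1 : (y ^ (n + 1)) ⊗ₜ[k] (1 : L) * comul (R := k) y =
          (y ^ (n + 1) * g) ⊗ₜ[k] y + (y ^ (n + 1 + 1)) ⊗ₜ[k] 1 + (y ^ (n + 1)) ⊗ₜ[k] 1 * w := by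
        rw [hΔy, mul_add, mul_add]
        simp [pow_succ]
      have h2 : (y ^ n * g) ⊗ₜ[k] y * comul (R := k) y =
          (y ^ n * g) ⊗ₜ[k] y * (g ⊗ₜ[k] y + w) + ν • (y ^ (n + 1) * g) ⊗ₜ[k] y := by
        rw [hΔy, mul_add, mul_add, mul_add, hlin]
        abel
      rw [sub_mul, sub_mul, smul_mul_assoc, h1, h2, ← Bialgebra.comul_mul, ← pow_succ]
      module
    rw [e]
    have hyn : y ^ n * g ∈ degreeFiltration T y (n + 1) := mul_mem T y (pow_mem T y n) hgT
    have hFT : degreeFiltration T y (n + 1) * T.toSubmodule ≤ degreeFiltration T y (n + 1) :=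
      mul_toSubmodule_le T y (n + 1)
    refine add_mem (add_mem ?_ ?_) (Submodule.smul_mem _ _ ?_)
    · exact tensorPart_mul_le T y n (Submodule.mul_mem_mul ih
        (comul_mem_of_mem_adjunction hT hgT hΔ
          (Submodule.mem_sup_right (Submodule.mem_span_singleton_self y))))
    · have h1 : (y ^ (n + 1)) ⊗ₜ[k] (1 : L) ∈ tensorPart T y (n + 1) :=
        Submodule.mem_sup_right (tmul_mem_tensorSub (pow_mem T y (n + 1)) (one_mem T))
      exact tensorPart_mul_tensorSub_le T y (n + 1) (Submodule.mul_mem_mul h1 hΔ)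
    · refine Submodule.mem_sup_left (mul_mem_tensorSub_top (X' := T.toSubmodule) (Y' := ⊤)
        (tmul_mem_tensorSub (Y := ⊤) hyn trivial) ?_ hFT)
      exact add_mem (tmul_mem_tensorSub hgT trivial) (tensorSub_mono le_rfl le_top hΔ)

lemma pow_notMem (hT : ∀ t ∈ T, comul (R := k) t ∈ tensorSub T.toSubmodule T.toSubmodule)
    (hgT : g ∈ T)
    (hΔ : comul (R := k) y - g ⊗ₜ[k] y - y ⊗ₜ[k] 1 ∈ tensorSub T.toSubmodule T.toSubmodule) {ν : k}
    (hν : g * y = ν • (y * g)) (hy : y ∉ T) {g' : L} (hg' : g' ∈ T) (hgg' : g * g' = 1) {p : ℕ}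
    (hne : ∀ n < p, 0 < n → ∑ i ∈ Finset.range n, ν ^ i ≠ 0) {n : ℕ} (hn : n < p) :
    y ^ n ∉ degreeFiltration T y n := by
  induction n with
  | zero =>
    rw [pow_zero, zero_eq, Submodule.mem_bot]
    intro h0
    apply hy
    rw [← mul_one y, h0, mul_zero]
    exact zero_mem T
  | succ n ih =>
    intro hmem
    obtain ⟨f, hf1, hf2⟩ : ∃ f : Module.Dual k L, f y = 1 ∧ ∀ t ∈ T.toSubmodule, f t = 0 := by
      obtain ⟨f, hfy, hfT⟩ := Submodule.exists_le_ker_of_notMem (p := T.toSubmodule) (v := y) hy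
      exact ⟨(f y)⁻¹ • f, by simp [hfy], fun t ht => by simp [show f t = 0 from hfT ht]⟩
    set s := ∑ i ∈ Finset.range (n + 1), ν ^ i with hs
    have h1 : s • (y ^ n * g) ⊗ₜ[k] y ∈ tensorPart T y n := by
      have h2 := comul_mem hT hgT hΔ n hmem
      have h3 : (y ^ (n + 1)) ⊗ₜ[k] (1 : L) ∈ tensorPart T y n :=
        Submodule.mem_sup_right (tmul_mem_tensorSub hmem (one_mem T))
      have h4 := sub_mem (sub_mem h2 h3) (comul_pow_mem hT hgT hΔ hν n)
      rwa [sub_sub_cancel] at h4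
    have h2 : y ^ n * g ∈ degreeFiltration T y n := by
      have := contract_mem_of_vanish hf2 h1
      rw [map_smul, contract_tmul, hf1, one_smul] at this
      exact (Submodule.smul_mem_iff _ (hne (n + 1) hn n.succ_pos)).1 this
    apply ih (by omega)
    have := mul_mem T y h2 hg'
    rwa [mul_assoc, hgg', mul_one] at this

lemma isPointed [CharZero k] [FiniteDimensional k L] {p : ℕ} (hp : p.Prime)
    (hdim : Module.finrank k L = p ^ 3) (hTdim : Module.finrank k T = p ^ 2)
    {c : L} (hc : IsGroupLikeElem k c)
    (hTtri : Triangular (Submonoid.powers c : Set L) T.toSubmodule)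
    (hinv : ∀ h ∈ Submonoid.powers c, ∃ h' ∈ T, h' * h = 1)
    (hT : ∀ t ∈ T, comul (R := k) t ∈ tensorSub T.toSubmodule T.toSubmodule) (hgT : g ∈ T)
    (hgp : g ^ p = 1)
    (hΔ : comul (R := k) y - g ⊗ₜ[k] y - y ⊗ₜ[k] 1 ∈ tensorSub T.toSubmodule T.toSubmodule)
    {ν : k} (hνp : ν ^ p = 1)
    (hν : g * y = ν • (y * g)) (hy : y ∉ T) : IsPointed k L := by
  have hE : Triangular (Submonoid.powers c : Set L) (adjunction T y) := by
    refine Triangular.step hTtri (one_mem (Submonoid.powers c)) ?_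
    have e : comul (R := k) y - y ⊗ₜ[k] 1 =
        (comul (R := k) y - g ⊗ₜ[k] y - y ⊗ₜ[k] 1) + g ⊗ₜ[k] y := by abel
    rw [e]
    exact add_mem (tensorSub_mono le_rfl le_top hΔ) (tmul_mem_tensorSub hgT trivial)
  have hne : ∀ n < p, 0 < n → ∑ i ∈ Finset.range n, ν ^ i ≠ 0 := by
    intro n hn hn0 hsum
    by_cases hν1 : ν = 1
    · rw [hν1] at hsum
      simp at hsum
      omega
    · have h1 : orderOf ν = p := by
        have := Fact.mk hp
        exact orderOf_eq_prime hνp hν1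
      have h2 := geom_sum_mul ν n
      rw [hsum, zero_mul] at h2
      have h3 := orderOf_dvd_of_pow_eq_one (sub_eq_zero.1 h2.symm)
      rw [h1] at h3
      exact absurd (Nat.le_of_dvd hn0 h3) (by omega)
  have hgg' : g * g ^ (p - 1) = 1 := by rw [← pow_succ', Nat.sub_add_cancel hp.pos, hgp]
  have hFtri : ∀ n, Triangular (Submonoid.powers c : Set L) (degreeFiltration T y n) :=
    triangular T y hTtri hE
  have htop : degreeFiltration T y p = ⊤ := by
    refine eq_top_of_filtration hdim hTdim (degreeFiltration T y) (fun n => y ^ n)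
      (le_succ T y) ?_ ?_
    · intro n t ht
      exact toSubmodule_mul_le T y (n + 1) (Submodule.mul_mem_mul ht (pow_mem T y n))
    · intro n hn t ht htu
      refine eq_zero_of_mul_mem hTtri hinv (hFtri n) (toSubmodule_mul_le T y n) (mul_one (1 : L)) ?_
        (pow_notMem hT hgT hΔ hν hy (T.pow_mem hgT _) hgg' hne hn) ht htu
      match n with
      | 0 => simp [Algebra.TensorProduct.one_def]
      | n + 1 =>
        have h1 := comul_pow_mem hT hgT hΔ hν n
        have h2 : tensorPart T y n ≤ tensorSub (degreeFiltration T y (n + 1)) ⊤ :=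
          sup_le (tensorSub_mono (le_succ T y n) le_rfl) (tensorSub_mono le_rfl le_top)
        have h3 : (∑ i ∈ Finset.range (n + 1), ν ^ i) • (y ^ n * g) ⊗ₜ[k] y ∈
            tensorSub (degreeFiltration T y (n + 1)) ⊤ :=
          Submodule.smul_mem _ _
            (tmul_mem_tensorSub (mul_mem T y (pow_mem T y n) hgT) trivial)
        simpa using add_mem (h2 h1) h3
  refine isPointed_of_triangular (htop ▸ (hFtri p).mono ?_)
  rintro _ ⟨i, rfl⟩
  exact hc.pow

end degreeFiltration

end Adjunction

end HopfClass

open HopfClass in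
/-- Let `p` be an odd prime and `L` a Hopf algebra of dimension `p³` containing a sub-Hopf
algebra `T` isomorphic to the Taft algebra `T_q` of dimension `p²`. If there are a grouplike
`g ∈ G(L)` and `y ∈ L` with `y ∉ T` such that `Δ(y) = g ⊗ y + y ⊗ 1 + y′` for some
`y′ ∈ T ⊗ T`, then `L` is pointed. -/
theorem pointed_of_taft_subalgebra_and_almost_skew_primitive
    (k : Type*) [Field k] [IsAlgClosed k] [CharZero k]
    (L : Type*) [Ring L] [HopfAlgebra k L] [FiniteDimensional k L]
    (p : ℕ) (hp : p.Prime) (hodd : Odd p) (q : k)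
    (hdim : Module.finrank k L = p ^ 3)
    (T : Subalgebra k L) (hT : IsTaftSubalgebra k p q T)
    (g y : L) (hg : g ∈ grouplikes k L) (hy : y ∉ T)
    (y' : L ⊗[k] L)
    (hy' : y' ∈ LinearMap.range (TensorProduct.map
      (Subalgebra.toSubmodule T).subtype (Subalgebra.toSubmodule T).subtype))
    (hΔ : CoalgebraStruct.comul (R := k) y = g ⊗ₜ[k] y + y ⊗ₜ[k] (1 : L) + y') :
    IsPointed k L := by
  obtain ⟨-, hTdim, c, x, hc, hx, hcp, -, -, rfl⟩ := hT
  replace hc := hc.isGroupLikeElem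
  have hg' : IsGroupLikeElem k g := IsGrouplikeWrt.isGroupLikeElem hg
  have hcT : c ∈ Algebra.adjoin k {c, x} := Algebra.subset_adjoin (by simp)
  have htri := triangular_adjoin_pair hc hx
  have hinv : ∀ h ∈ Submonoid.powers c, ∃ h' ∈ Algebra.adjoin k {c, x}, h' * h = 1 := by
    rintro _ ⟨i, rfl⟩
    refine ⟨(c ^ (p - 1)) ^ i, pow_mem (pow_mem hcT _) _, ?_⟩
    rw [← pow_mul, ← pow_add, ← Nat.succ_mul, Nat.succ_eq_add_one, Nat.sub_add_cancel hp.pos,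
      pow_mul, hcp, one_pow]
  by_cases hgc : g ∈ Submonoid.powers c
  swap
  · exact isPointed_of_grouplike_not_mem hp hdim hTdim hc htri hinv hg' hgc
  obtain ⟨i, rfl⟩ := hgc
  have hgT : c ^ i ∈ Algebra.adjoin k {c, x} := pow_mem hcT i
  have hgp : (c ^ i) ^ p = 1 := by rw [← pow_mul, mul_comm, pow_mul, hcp, one_pow]
  rw [range_map_subtype] at hy'
  obtain ⟨v, ν, hv, hνp, hν, hΔv⟩ := exists_conj_eigenvector hp.pos hg' hgT hgp hy
    (by rw [hΔ]; convert hy' using 1; abel)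
  exact degreeFiltration.isPointed hp hdim hTdim hc htri hinv
    (fun t ht => comul_mem_adjoin_pair hc hx ht) hgT hgp hΔv hνp hν hv
end
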